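/- arXiv:math/0306333 — 2 statements merged into one kernel-verified Lean document; each statement's English description precedes it below -/
import Mathlib

section
/- Let k be a field of characteristic zero and N, n ≥ 1. For each 1 ≤ j ≤ n fix an integer ℓ_j ≥ 2 and a submonoid H_j of the monoid of k-algebra endomorphisms of k(t) containing the endomorphism t ↦ t^{ℓ_j}. For any field extension K of k, each element of H_j extends to a K-algebra endomorphism of K(t) (sending t to the same rational function with coefficients in k), so H_j acts on K(t), and the product monoid ∏_{j=1}^n H_j acts on K(x_1,…,x_n), the j-th factor acting through the variable x_j. Assume that for every field extension K of k and every algebraic closure K̄ of K, every 1-cocycle of H_j with values in GL_N(K̄(t)) is cohomologous to a 1-cocycle with constant values in GL_N(K̄) (equivalently, to a monoid homomorphism H_j → GL_N(K̄)). Then for every field extension K of k, every 1-cocycle of ∏_{j=1}^n H_j with values in GL_N(K(x_1,…,x_n)) is cohomologous to a monoid homomorphism into GL_N(K). -/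
namespace PCR
open RatFunc

lemma ratFunc_hom_ext {K F : Type*} [Field K] [Field F] (a b : RatFunc K →+* F)
    (hC : ∀ c, a (RatFunc.C c) = b (RatFunc.C c)) (hX : a RatFunc.X = b RatFunc.X) : a = b := by
  have h : a.comp (algebraMap (Polynomial K) (RatFunc K)) =
      b.comp (algebraMap (Polynomial K) (RatFunc K)) := by
    apply Polynomial.ringHom_ext
    · intro c; simpa using hC c
    · simpa using hX
  exact IsFractionRing.injective_comp_algebraMap h

lemma ratFunc_mem_subfield {K : Type*} [Field K] (S : Subfield (RatFunc K))
    (hC : ∀ c, RatFunc.C c ∈ S) (hX : RatFunc.X ∈ S) (r : RatFunc K) : r ∈ S := by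
  have hp : ∀ p : Polynomial K, algebraMap (Polynomial K) (RatFunc K) p ∈ S := by
    intro p
    induction p using Polynomial.induction_on' with
    | add p q hp hq => rw [map_add]; exact S.add_mem hp hq
    | monomial n a =>
      rw [RatFunc.algebraMap_monomial]
      exact S.mul_mem (hC a) (S.pow_mem hX n)
  rw [← RatFunc.num_div_denom r]
  exact S.div_mem (hp _) (hp _)

lemma exists_lift {K F : Type*} [Field K] [Field F] (φ : K →+* F) (x : F)
    (h : ∀ p : Polynomial K, p.eval₂ φ x = 0 → p = 0) :
    ∃ θ : RatFunc K →+* F, (∀ c, θ (RatFunc.C c) = φ c) ∧ θ RatFunc.X = x := by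
  refine ⟨RatFunc.liftRingHom (Polynomial.eval₂RingHom φ x) ?_, ?_, ?_⟩
  · intro p hp
    simp only [Submonoid.mem_comap, mem_nonZeroDivisors_iff_ne_zero] at hp ⊢
    exact fun h0 => hp (h p (by simpa using h0))
  · intro c; rw [RatFunc.liftRingHom_C]; simp
  · rw [RatFunc.liftRingHom_X]; simp

lemma exists_bc {k L : Type*} [Field k] [Field L] (φ : k →+* L) :
    ∃ θ : RatFunc k →+* RatFunc L, (∀ c, θ (RatFunc.C c) = RatFunc.C (φ c)) ∧
      θ RatFunc.X = RatFunc.X := by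
  refine exists_lift ((RatFunc.C).comp φ) RatFunc.X ?_
  intro p hp
  have : algebraMap (Polynomial L) (RatFunc L) (p.map φ) = 0 := by
    rw [← RatFunc.aeval_X_left_eq_algebraMap, Polynomial.aeval_def, Polynomial.eval₂_map]
    exact hp
  have h2 := (map_eq_zero_iff _ (RatFunc.algebraMap_injective L)).1 this
  exact (Polynomial.map_eq_zero φ).1 h2

noncomputable def bc {k L : Type*} [Field k] [Field L] (φ : k →+* L) :
    RatFunc k →+* RatFunc L := (exists_bc φ).choose

@[simp] lemma bc_C {k L : Type*} [Field k] [Field L] (φ : k →+* L) (c : k) :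
    bc φ (RatFunc.C c) = RatFunc.C (φ c) := (exists_bc φ).choose_spec.1 c

@[simp] lemma bc_X {k L : Type*} [Field k] [Field L] (φ : k →+* L) :
    bc φ RatFunc.X = RatFunc.X := (exists_bc φ).choose_spec.2

lemma bc_poly {k L : Type*} [Field k] [Field L] (φ : k →+* L) (p : Polynomial k) :
    bc φ (algebraMap _ _ p) = algebraMap _ _ (p.map φ) := by
  induction p using Polynomial.induction_on' with
  | add p q hp hq => simp [hp, hq]
  | monomial n a => simp [RatFunc.algebraMap_monomial]

lemma bc_const {k L : Type*} [Field k] [Field L] (φ : k →+* L) (r : RatFunc k) (a : L)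
    (h : bc φ r = RatFunc.C a) : ∃ c, r = RatFunc.C c := by
  have hq : algebraMap (Polynomial k) (RatFunc k) r.denom ≠ 0 :=
    RatFunc.algebraMap_ne_zero r.denom_ne_zero
  have h1 : r * algebraMap _ _ r.denom = algebraMap _ _ r.num := by
    conv_lhs => rw [← RatFunc.num_div_denom r]
    rw [RatFunc.num_div_denom]
    conv_lhs => lhs; rw [← RatFunc.num_div_denom r]
    field_simp
  have h2 := congrArg (bc φ) h1
  rw [map_mul, h, bc_poly, bc_poly, ← RatFunc.algebraMap_C, ← map_mul] at h2
  have h3 := RatFunc.algebraMap_injective L h2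
  have h4 := congrArg (fun p => p.coeff r.denom.natDegree) h3
  simp only [Polynomial.coeff_C_mul, Polynomial.coeff_map, Polynomial.coeff_natDegree,
    (RatFunc.monic_denom r).leadingCoeff, map_one, mul_one] at h4
  rw [h4, ← Polynomial.map_C, ← Polynomial.map_mul] at h3
  have h5 := Polynomial.map_injective φ φ.injective h3
  refine ⟨r.num.coeff r.denom.natDegree, ?_⟩
  apply mul_right_cancel₀ hq
  rw [h1, ← RatFunc.algebraMap_C, ← map_mul, h5]

lemma exists_ext {k L : Type*} [Field k] [Field L] (φ : k →+* L)
    (σ : RatFunc k →ₐ[k] RatFunc k) :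
    ∃ θ : RatFunc L →+* RatFunc L, (∀ c, θ (RatFunc.C c) = RatFunc.C c) ∧
      θ RatFunc.X = bc φ (σ RatFunc.X) := by
  refine exists_lift (RatFunc.C) _ ?_
  have hnc : ¬ ∃ c, bc φ (σ RatFunc.X) = RatFunc.C c := by
    rintro ⟨c, hc⟩
    obtain ⟨d, hd⟩ := bc_const φ _ _ hc
    have : σ RatFunc.X = σ (RatFunc.C d) := by
      rw [hd, ← RatFunc.algebraMap_eq_C, AlgHom.commutes]
    have h2 := σ.toRingHom.injective this
    have h3 := congrArg RatFunc.num h2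
    simp at h3
    have := congrArg Polynomial.natDegree h3
    simp at this
  have := RatFunc.transcendental_of_ne_C _ hnc
  intro p hp
  rw [transcendental_iff] at this
  exact this p hp

noncomputable def ext {k L : Type*} [Field k] [Field L] (φ : k →+* L)
    (σ : RatFunc k →ₐ[k] RatFunc k) : RatFunc L →+* RatFunc L := (exists_ext φ σ).choose

@[simp] lemma ext_C {k L : Type*} [Field k] [Field L] (φ : k →+* L)
    (σ : RatFunc k →ₐ[k] RatFunc k) (c : L) :
    ext φ σ (RatFunc.C c) = RatFunc.C c := (exists_ext φ σ).choose_spec.1 c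

@[simp] lemma ext_X {k L : Type*} [Field k] [Field L] (φ : k →+* L)
    (σ : RatFunc k →ₐ[k] RatFunc k) :
    ext φ σ RatFunc.X = bc φ (σ RatFunc.X) := (exists_ext φ σ).choose_spec.2

lemma algHom_C {k : Type*} [Field k] (σ : RatFunc k →ₐ[k] RatFunc k) (c : k) :
    σ (RatFunc.C c) = RatFunc.C c := by
  rw [← RatFunc.algebraMap_eq_C, AlgHom.commutes]

lemma ext_bc {k L : Type*} [Field k] [Field L] (φ : k →+* L)
    (σ : RatFunc k →ₐ[k] RatFunc k) (r : RatFunc k) : ext φ σ (bc φ r) = bc φ (σ r) := by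
  have : (ext φ σ).comp (bc φ) = (bc φ).comp (σ : RatFunc k →+* RatFunc k) := by
    apply ratFunc_hom_ext
    · intro c; simp [algHom_C]
    · simp
  exact DFunLike.congr_fun this r

lemma ext_mul {k L : Type*} [Field k] [Field L] (φ : k →+* L)
    (σ τ : RatFunc k →ₐ[k] RatFunc k) : ext φ (σ * τ) = (ext φ σ).comp (ext φ τ) := by
  apply ratFunc_hom_ext
  · intro c; simp
  · simp [ext_bc]

lemma bc_comp {k L M : Type*} [Field k] [Field L] [Field M] (φ : k →+* L) (ψ : L →+* M)
    (r : RatFunc k) : bc ψ (bc φ r) = bc (ψ.comp φ) r := by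
  have : (bc ψ).comp (bc φ) = bc (ψ.comp φ) := by
    apply ratFunc_hom_ext
    · intro c; simp
    · simp
  exact DFunLike.congr_fun this r

lemma ext_comp_bc {k L M : Type*} [Field k] [Field L] [Field M] (φ : k →+* L) (ψ : L →+* M)
    (σ : RatFunc k →ₐ[k] RatFunc k) (r : RatFunc L) :
    ext (ψ.comp φ) σ (bc ψ r) = bc ψ (ext φ σ r) := by
  have : (ext (ψ.comp φ) σ).comp (bc ψ) = (bc ψ).comp (ext φ σ) := by
    apply ratFunc_hom_ext
    · intro c; simp
    · simp [bc_comp]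
  exact DFunLike.congr_fun this r

lemma pow_X {k : Type*} [Field k] (e : RatFunc k →ₐ[k] RatFunc k) (l : ℕ)
    (he : e RatFunc.X = RatFunc.X ^ l) (m : ℕ) : (e ^ m) RatFunc.X = RatFunc.X ^ (l ^ m) := by
  induction m with
  | zero => simp
  | succ m ih => rw [pow_succ, AlgHom.mul_apply, he, map_pow, ih, ← pow_mul, pow_succ]

lemma span_bounded {L : Type*} [Field L] (S : Set (RatFunc L)) (hS : S.Finite) :
    ∃ (Q : Polynomial L) (D : ℕ), Q ≠ 0 ∧ ∀ v ∈ Submodule.span L S, ∃ p : Polynomial L,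
      p.natDegree ≤ D ∧ algebraMap _ (RatFunc L) p = algebraMap _ _ Q * v := by
  obtain ⟨Q, hQ⟩ := IsLocalization.exist_integer_multiples_of_finset
    (nonZeroDivisors (Polynomial L)) hS.toFinset
  have hQ0 : (Q : Polynomial L) ≠ 0 := nonZeroDivisors.ne_zero Q.2
  have hQ' : ∀ v ∈ hS.toFinset, ∃ p : Polynomial L,
      algebraMap _ (RatFunc L) p = algebraMap _ _ (Q : Polynomial L) * v := by
    intro v hv
    obtain ⟨p, hp⟩ := hQ v hv
    exact ⟨p, by rw [hp, Algebra.smul_def]⟩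
  clear hQ
  obtain ⟨Q, hQm⟩ := Q
  simp only at hQ0 hQ'
  choose! P hP using hQ'
  refine ⟨Q, hS.toFinset.sup (fun v => (P v).natDegree), hQ0, ?_⟩
  intro v hv
  induction hv using Submodule.span_induction with
  | mem v hv =>
    have hv' : v ∈ hS.toFinset := by simpa using hv
    exact ⟨P v, Finset.le_sup (f := fun v => (P v).natDegree) hv', hP v hv'⟩
  | zero => exact ⟨0, by simp, by simp⟩
  | add a b _ _ ha hb =>
    obtain ⟨p, hp, hp'⟩ := ha
    obtain ⟨q, hq, hq'⟩ := hb
    exact ⟨p + q, (Polynomial.natDegree_add_le _ _).trans (max_le hp hq),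
      by rw [map_add, hp', hq', mul_add]⟩
  | smul c a _ ha =>
    obtain ⟨p, hp, hp'⟩ := ha
    refine ⟨Polynomial.C c * p, (Polynomial.natDegree_C_mul_le _ _).trans hp, ?_⟩
    rw [map_mul, hp', RatFunc.smul_eq_C_mul, RatFunc.algebraMap_C]; ring

/-- Constancy lemma. -/
lemma const_of_span {L : Type*} [Field L] (u : RatFunc L) (S : Set (RatFunc L)) (hS : S.Finite)
    (h : ∀ m : ℕ, ∃ M ≥ m, ∃ ψ : RatFunc L →+* RatFunc L, (∀ c, ψ (RatFunc.C c) = RatFunc.C c) ∧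
      ψ RatFunc.X = RatFunc.X ^ M ∧ ψ u ∈ Submodule.span L S) : ∃ c, u = RatFunc.C c := by
  obtain ⟨Q, D, hQ0, key⟩ := span_bounded S hS
  obtain ⟨M, hM, ψ, hψC, hψX, hψu⟩ := h (Q.natDegree + D + 1)
  obtain ⟨p, hpD, hp⟩ := key _ hψu
  have hψ : ∀ q : Polynomial L, ψ (algebraMap _ _ q) = algebraMap _ _ (Polynomial.expand L M q) := by
    intro q
    induction q using Polynomial.induction_on' with
    | add p q hp hq => simp [hp, hq]
    | monomial n a =>
      rw [RatFunc.algebraMap_monomial, Polynomial.expand_monomial, RatFunc.algebraMap_monomial,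
        map_mul, map_pow, hψC, hψX, mul_comm n M, pow_mul]
  have hu : ψ u * algebraMap _ _ (Polynomial.expand L M u.denom) =
      algebraMap _ _ (Polynomial.expand L M u.num) := by
    rw [← hψ, ← hψ, ← map_mul]
    congr 1
    rw [← eq_div_iff (RatFunc.algebraMap_ne_zero u.denom_ne_zero), RatFunc.num_div_denom]
  have hpoly : p * Polynomial.expand L M u.denom = Q * Polynomial.expand L M u.num := by
    apply RatFunc.algebraMap_injective L
    rw [map_mul, map_mul, hp, ← hu]; ring
  have hcop : IsCoprime (Polynomial.expand L M u.denom) (Polynomial.expand L M u.num) := by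
    obtain ⟨a, b, hab⟩ := (RatFunc.isCoprime_num_denom u).symm
    refine ⟨Polynomial.expand L M a, Polynomial.expand L M b, ?_⟩
    rw [← map_mul, ← map_mul, ← map_add, hab, map_one]
  have hdvd : Polynomial.expand L M u.denom ∣ (Q : Polynomial L) :=
    hcop.dvd_of_dvd_mul_right (Dvd.intro_left _ hpoly)
  have hdeg := Polynomial.natDegree_le_of_dvd hdvd hQ0
  rw [Polynomial.natDegree_expand] at hdeg
  have hM0 : 0 < M := by omega
  have hd0 : u.denom.natDegree = 0 := by
    by_contra hne
    have : M ≤ u.denom.natDegree * M := Nat.le_mul_of_pos_left _ (Nat.pos_of_ne_zero hne)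
    omega
  have hd1 : u.denom = 1 := (RatFunc.monic_denom u).natDegree_eq_zero.1 hd0
  have hn0 : u.num.natDegree = 0 := by
    by_contra hne
    have hnum : u.num ≠ 0 := by rintro h0; simp [h0] at hne
    have h1 : M ≤ u.num.natDegree * M := Nat.le_mul_of_pos_left _ (Nat.pos_of_ne_zero hne)
    rw [hd1, map_one, mul_one] at hpoly
    have h2 := congrArg Polynomial.natDegree hpoly
    rw [Polynomial.natDegree_mul hQ0 ((Polynomial.expand_ne_zero hM0).2 hnum),
      Polynomial.natDegree_expand] at h2
    omega
  refine ⟨u.num.coeff 0, ?_⟩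
  rw [← RatFunc.algebraMap_C, ← Polynomial.eq_C_of_natDegree_eq_zero hn0]
  conv_lhs => rw [← RatFunc.num_div_denom u, hd1]
  simp

lemma coords {L Lb I : Type*} [Field L] [Field Lb] [Algebra L Lb] [Algebra.IsAlgebraic L Lb]
    (b : Module.Basis I L Lb) :
    ∃ R : RatFunc Lb →+ (I →₀ RatFunc L),
      (∀ r a i, R (bc (algebraMap L Lb) r * RatFunc.C a) i = r * RatFunc.C (b.repr a i)) ∧
      ∀ u, u = (R u).sum fun i r => bc (algebraMap L Lb) r * RatFunc.C (b i) := by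
  let alg : Algebra (RatFunc L) (RatFunc Lb) := (bc (algebraMap L Lb)).toAlgebra
  have hsm : ∀ (r : RatFunc L) (u : RatFunc Lb), r • u = bc (algebraMap L Lb) r * u :=
    fun r u => rfl
  have hCa : ∀ a : Lb, RatFunc.C a = Finsupp.linearCombination (RatFunc L)
      (fun i => (RatFunc.C (b i) : RatFunc Lb)) ((b.repr a).mapRange RatFunc.C (map_zero _)) := by
    intro a
    conv_lhs => rw [← b.linearCombination_repr a]
    rw [Finsupp.linearCombination_apply, Finsupp.linearCombination_apply,
      Finsupp.sum_mapRange_index (by intro i; rw [zero_smul]), Finsupp.sum, Finsupp.sum, map_sum]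
    refine Finset.sum_congr rfl fun i _ => ?_
    rw [hsm, bc_C, Algebra.smul_def, map_mul]
  have hli : LinearIndependent (RatFunc L) (fun i => (RatFunc.C (b i) : RatFunc Lb)) := by
    rw [linearIndependent_iff']
    intro s r hr i hi
    obtain ⟨Q, hQ⟩ := IsLocalization.exist_integer_multiples (nonZeroDivisors (Polynomial L)) s r
    have hQ0 : algebraMap _ (RatFunc L) (Q : Polynomial L) ≠ 0 :=
      RatFunc.algebraMap_ne_zero (nonZeroDivisors.ne_zero Q.2)
    have hQ' : ∀ i ∈ s, ∃ p : Polynomial L,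
        algebraMap _ (RatFunc L) p = algebraMap _ _ (Q : Polynomial L) * r i := by
      intro i hi
      obtain ⟨p, hp⟩ := hQ i hi
      exact ⟨p, by rw [hp, Algebra.smul_def]⟩
    choose! p hp using hQ'
    have h1 : ∑ i ∈ s, (p i).map (algebraMap L Lb) * Polynomial.C (b i) = 0 := by
      apply RatFunc.algebraMap_injective Lb
      rw [map_zero, map_sum]
      have h2 := congrArg (fun u => bc (algebraMap L Lb) (algebraMap _ _ (Q : Polynomial L)) * u) hr
      simp only [mul_zero, Finset.mul_sum] at h2
      rw [← h2]
      refine Finset.sum_congr rfl fun i hi => ?_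
      rw [hsm, map_mul, ← bc_poly, hp i hi, map_mul, RatFunc.algebraMap_C, mul_assoc]
    have h3 : p i = 0 := by
      ext m
      have h4 := congrArg (fun q => q.coeff m) h1
      simp only [Polynomial.finsetSum_coeff, Polynomial.coeff_mul_C, Polynomial.coeff_map,
        Polynomial.coeff_zero, ← Algebra.smul_def] at h4
      rw [Polynomial.coeff_zero]
      exact (linearIndependent_iff'.1 b.linearIndependent) s (fun i => (p i).coeff m) h4 i hi
    have h5 := hp i hi
    rw [h3, map_zero] at h5
    exact (mul_eq_zero.1 h5.symm).resolve_left hQ0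
  have hsp : ⊤ ≤ Submodule.span (RatFunc L) (Set.range (fun i => (RatFunc.C (b i) : RatFunc Lb))) := by
    have hC : ∀ a : Lb, RatFunc.C a ∈
        Submodule.span (RatFunc L) (Set.range (fun i => (RatFunc.C (b i) : RatFunc Lb))) := by
      intro a
      rw [hCa a, ← Finsupp.range_linearCombination]
      exact LinearMap.mem_range_self _ _
    have hp : ∀ p : Polynomial Lb, algebraMap _ (RatFunc Lb) p ∈
        Submodule.span (RatFunc L) (Set.range (fun i => (RatFunc.C (b i) : RatFunc Lb))) := by
      intro p
      induction p using Polynomial.induction_on' with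
      | add p q hp hq => rw [map_add]; exact Submodule.add_mem _ hp hq
      | monomial n a =>
        rw [RatFunc.algebraMap_monomial]
        have : RatFunc.C a * RatFunc.X ^ n = (RatFunc.X ^ n : RatFunc L) • RatFunc.C a := by
          rw [hsm, map_pow, bc_X, mul_comm]
        rw [this]
        exact Submodule.smul_mem _ _ (hC a)
    intro u _
    obtain ⟨q, hq0, d, hd⟩ := Polynomial.exists_dvd_map_of_isAlgebraic (R := L) u.denom_ne_zero
    have hd1 : algebraMap _ (RatFunc Lb) u.denom ≠ 0 := RatFunc.algebraMap_ne_zero u.denom_ne_zero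
    have hq1 : bc (algebraMap L Lb) (algebraMap _ _ q) ≠ 0 := by
      rw [bc_poly]
      exact RatFunc.algebraMap_ne_zero ((Polynomial.map_ne_zero_iff (algebraMap L Lb).injective).2 hq0)
    have : u = (algebraMap _ (RatFunc L) q)⁻¹ • algebraMap _ (RatFunc Lb) (u.num * d) := by
      rw [hsm, map_inv₀, eq_inv_mul_iff_mul_eq₀ hq1, bc_poly, hd]
      have h1 : u * algebraMap _ _ u.denom = algebraMap _ _ u.num := by
        rw [← eq_div_iff hd1, RatFunc.num_div_denom]
      rw [map_mul, map_mul, ← h1]; ring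
    rw [this]
    exact Submodule.smul_mem _ _ (hp _)
  let B := Module.Basis.mk hli hsp
  refine ⟨B.repr.toLinearMap.toAddMonoidHom, ?_, ?_⟩
  · intro r a i
    have : B.repr (r • RatFunc.C a) i = r * RatFunc.C (b.repr a i) := by
      rw [map_smul, hCa a]
      have hB : (fun i => (RatFunc.C (b i) : RatFunc Lb)) = B := (Module.Basis.coe_mk hli hsp).symm
      rw [hB, B.repr_linearCombination]
      simp
    exact this
  · intro u
    conv_lhs => rw [← B.linearCombination_repr u]
    rw [Finsupp.linearCombination_apply]
    refine Finset.sum_congr rfl fun i _ => ?_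
    change B.repr u i • B i = bc (algebraMap L Lb) (B.repr u i) * RatFunc.C (b i)
    rw [hsm]
    simp [B]

lemma matrix_cancel {R : Type*} [CommRing R] {N : ℕ} {g A B : Matrix (Fin N) (Fin N) R}
    (hg : IsUnit g) (h : g * A = g * B) : A = B := hg.mul_left_cancel h

lemma isUnit_map {R S : Type*} [CommRing R] [CommRing S] {N : ℕ} {g : Matrix (Fin N) (Fin N) R}
    (hg : IsUnit g) (φ : R →+* S) : IsUnit (g.map φ) := hg.map (φ.mapMatrix)

lemma isUnit_of_map {R S : Type*} [Field R] [Field S] {N : ℕ} {g : Matrix (Fin N) (Fin N) R}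
    (φ : R →+* S) (hg : IsUnit (g.map φ)) : IsUnit g := by
  rw [Matrix.isUnit_iff_isUnit_det, isUnit_iff_ne_zero] at hg ⊢
  rintro h0
  apply hg
  have := RingHom.map_det φ g
  rw [h0, map_zero] at this
  exact this.symm

lemma map_inj {R S : Type*} [Field R] [Field S] {N : ℕ} {A B : Matrix (Fin N) (Fin N) R}
    (φ : R →+* S) (h : A.map φ = B.map φ) : A = B :=
  Matrix.map_injective φ.injective h

lemma coord_ext {L Lb I M : Type*} [Field L] [Field Lb] [Algebra L Lb] [AddCommGroup M]
    (b : Module.Basis I L Lb) (R : RatFunc Lb →+ (I →₀ RatFunc L))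
    (hR2 : ∀ u, u = (R u).sum fun i r => bc (algebraMap L Lb) r * RatFunc.C (b i))
    (A B : RatFunc Lb →+ M)
    (h : ∀ r a, A (bc (algebraMap L Lb) r * RatFunc.C a) = B (bc (algebraMap L Lb) r * RatFunc.C a))
    (u : RatFunc Lb) : A u = B u := by
  rw [hR2 u, Finsupp.sum, map_sum, map_sum]
  exact Finset.sum_congr rfl fun i _ => h _ _

set_option maxHeartbeats 1000000 in
lemma descent {k L Lb : Type*} [Field k] [Field L] [Field Lb] [Algebra L Lb]
    [Algebra.IsAlgebraic L Lb] [Infinite L] {N : ℕ} (φ : k →+* L)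
    (Hj : Submonoid (RatFunc k →ₐ[k] RatFunc k)) (l : ℕ) (hl : 2 ≤ l)
    (e : RatFunc k →ₐ[k] RatFunc k) (he : e ∈ Hj) (heX : e RatFunc.X = RatFunc.X ^ l)
    (f : Hj → Matrix (Fin N) (Fin N) (RatFunc L)) (hf : ∀ σ, IsUnit (f σ))
    (g : Matrix (Fin N) (Fin N) (RatFunc Lb)) (hg : IsUnit g)
    (hgC : ∀ σ : Hj, ∃ C : Matrix (Fin N) (Fin N) Lb, IsUnit C ∧
      (f σ).map (bc (algebraMap L Lb)) * g.map (ext ((algebraMap L Lb).comp φ) σ) =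
        g * C.map RatFunc.C) :
    ∃ g : Matrix (Fin N) (Fin N) (RatFunc L), IsUnit g ∧ ∀ σ : Hj,
      ∃ C : Matrix (Fin N) (Fin N) L, IsUnit C ∧
        f σ * g.map (ext φ σ) = g * C.map RatFunc.C := by
  classical
  obtain ⟨I, ⟨b⟩⟩ : ∃ I : Set Lb, Nonempty (Module.Basis I L Lb) :=
    ⟨_, ⟨Module.Basis.ofVectorSpace L Lb⟩⟩
  obtain ⟨R, hR1, hR2⟩ := coords b
  set j := bc (algebraMap L Lb) with hj
  choose D hDu hD using hgC
  obtain ⟨ginv, hginv⟩ := hg.exists_left_inv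
  -- coordinate maps
  have hRj : ∀ r u i, R (j r * u) i = r * R u i := by
    intro r u i
    refine coord_ext b R hR2
      (((Finsupp.applyAddHom i).comp R).comp (AddMonoidHom.mulLeft (j r)))
      ((AddMonoidHom.mulLeft r).comp ((Finsupp.applyAddHom i).comp R)) ?_ u
    intro s a
    change R (j r * (j s * RatFunc.C a)) i = r * R (j s * RatFunc.C a) i
    rw [← mul_assoc, ← map_mul, hR1, hR1, mul_assoc]
  have hRρ : ∀ (σ : RatFunc k →ₐ[k] RatFunc k) u i,
      R (ext ((algebraMap L Lb).comp φ) σ u) i = ext φ σ (R u i) := by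
    intro σ u i
    refine coord_ext b R hR2
      (((Finsupp.applyAddHom i).comp R).comp (ext ((algebraMap L Lb).comp φ) σ).toAddMonoidHom)
      ((ext φ σ).toAddMonoidHom.comp ((Finsupp.applyAddHom i).comp R)) ?_ u
    intro s a
    change R (ext ((algebraMap L Lb).comp φ) σ (j s * RatFunc.C a)) i =
      ext φ σ (R (j s * RatFunc.C a) i)
    rw [map_mul, ext_C, hj, ext_comp_bc, hR1, hR1, map_mul, ext_C]
  -- the components of `g`
  let gc : I → Matrix (Fin N) (Fin N) (RatFunc L) := fun i => g.map (fun u => R u i)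
  let S : Set (RatFunc Lb) := ⋃ x : Fin N, ⋃ y : Fin N, ⋃ z : Fin N, ⋃ w : Fin N,
    (fun i => ginv x y * j (R (g z w) i)) '' ((R (g z w)).support : Set I)
  have hS : S.Finite :=
    Set.finite_iUnion fun x => Set.finite_iUnion fun y => Set.finite_iUnion fun z =>
      Set.finite_iUnion fun w => (Finset.finite_toSet _).image _
  have hSmem : ∀ x y z w i, ∀ a : Lb,
      ginv x y * j (R (g z w * RatFunc.C a) i) ∈ Submodule.span Lb S := by
    intro x y z w i a
    have h1 : R (g z w * RatFunc.C a) i =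
        ∑ i' ∈ (R (g z w)).support, R (g z w) i' * RatFunc.C (b.repr (b i' * a) i) := by
      conv_lhs => rw [hR2 (g z w)]
      rw [Finsupp.sum, Finset.sum_mul, map_sum, Finsupp.finsetSum_apply]
      refine Finset.sum_congr rfl fun i' _ => ?_
      rw [mul_assoc, ← map_mul, hR1]
    rw [h1, map_sum, Finset.mul_sum]
    refine Submodule.sum_mem _ fun i' hi' => ?_
    have h2 : ginv x y * j (R (g z w) i' * RatFunc.C (b.repr (b i' * a) i)) =
        (algebraMap L Lb (b.repr (b i' * a) i)) • (ginv x y * j (R (g z w) i')) := by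
      rw [RatFunc.smul_eq_C_mul, map_mul, hj, bc_C]; ring
    rw [h2]
    refine Submodule.smul_mem _ _ (Submodule.subset_span ?_)
    simp only [S, Set.mem_iUnion]
    exact ⟨x, y, z, w, i', hi', rfl⟩
  have hconst : ∀ i, ∃ M : Matrix (Fin N) (Fin N) Lb, (gc i).map j = g * M.map RatFunc.C := by
    intro i
    have hu : ∀ p q, ∃ c, (ginv * (gc i).map j) p q = RatFunc.C c := by
      intro p q
      refine const_of_span _ S hS ?_
      intro m
      let σ : Hj := ⟨e ^ m, Hj.pow_mem he m⟩
      refine ⟨l ^ m, (Nat.lt_pow_self hl).le, ext ((algebraMap L Lb).comp φ) σ,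
        fun c => ext_C _ _ c, ?_, ?_⟩
      · rw [ext_X]
        change bc _ ((e ^ m) RatFunc.X) = _
        rw [pow_X e l heX, map_pow, bc_X]
      · obtain ⟨Dinv, hDinv⟩ := (hDu σ).exists_left_inv
        set ψ := ext ((algebraMap L Lb).comp φ) σ with hψ
        have e1 : f σ * (gc i).map (ext φ σ) = (g * (D σ).map RatFunc.C).map (fun u => R u i) := by
          rw [← hD σ]
          ext x y
          simp only [Matrix.mul_apply, Matrix.map_apply, map_sum, Finsupp.finsetSum_apply, hRj,
            gc, hRρ]
        have e2 : (g * (D σ).map RatFunc.C) * (ginv * (gc i).map j).map ψ =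
            (f σ * (gc i).map (ext φ σ)).map j := by
          rw [← hD σ, Matrix.map_mul, Matrix.map_mul, Matrix.mul_assoc, ← Matrix.mul_assoc (g.map ψ),
            ← Matrix.map_mul, mul_eq_one_comm.1 hginv]
          have e3 : ((gc i).map j).map ψ = ((gc i).map (ext φ σ)).map j := by
            ext x y
            simp only [Matrix.map_apply]
            exact ext_comp_bc φ (algebraMap L Lb) σ _
          rw [e3]
          simp
        have e4 : (ginv * (gc i).map j).map ψ = Dinv.map RatFunc.C *
            (ginv * ((g * (D σ).map RatFunc.C).map (fun u => R u i)).map j) := by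
          rw [← e1, ← e2]
          have e5 : ginv * (g * (D σ).map RatFunc.C * (ginv * (gc i).map j).map ψ) =
              (D σ).map RatFunc.C * (ginv * (gc i).map j).map ψ := by
            rw [← Matrix.mul_assoc, ← Matrix.mul_assoc, hginv, Matrix.one_mul]
          rw [e5, ← Matrix.mul_assoc, ← Matrix.map_mul, hDinv]
          simp
        have e6 : ψ ((ginv * (gc i).map j) p q) = (ginv * (gc i).map j).map ψ p q := rfl
        rw [e6, e4, Matrix.mul_apply]
        refine Submodule.sum_mem _ fun x _ => ?_
        rw [Matrix.map_apply, ← RatFunc.smul_eq_C_mul]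
        refine Submodule.smul_mem _ _ ?_
        rw [Matrix.mul_apply]
        refine Submodule.sum_mem _ fun y _ => ?_
        rw [Matrix.map_apply, Matrix.map_apply, Matrix.mul_apply, map_sum,
          Finsupp.finsetSum_apply, map_sum, Finset.mul_sum]
        refine Submodule.sum_mem _ fun z _ => ?_
        exact hSmem _ _ _ _ _ _
    choose M hM using hu
    refine ⟨Matrix.of M, ?_⟩
    have : (Matrix.of M).map RatFunc.C = ginv * (gc i).map j := by
      ext p q; rw [hM]; rfl
    rw [this, ← Matrix.mul_assoc, mul_eq_one_comm.1 hginv, Matrix.one_mul]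
  choose M hM using hconst
  let s : Finset I := Finset.univ.biUnion fun z => Finset.univ.biUnion fun w => (R (g z w)).support
  have hgsum : ∀ z w, g z w = ∑ i ∈ s, j (gc i z w) * RatFunc.C (b i) := by
    intro z w
    conv_lhs => rw [hR2 (g z w)]
    refine Finset.sum_subset ?_ ?_
    · intro i hi
      simp only [s, Finset.mem_biUnion, Finset.mem_univ, true_and]
      exact ⟨z, w, hi⟩
    · intro i _ hi
      simp [Finsupp.notMem_support_iff.1 hi]
  have hone : ∑ i ∈ s, b i • M i = 1 := by
    apply map_inj (RatFunc.C)
    apply matrix_cancel hg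
    have e1 : g * (∑ i ∈ s, b i • M i).map RatFunc.C =
        ∑ i ∈ s, (RatFunc.C (b i) : RatFunc Lb) • (g * (M i).map RatFunc.C) := by
      have : (∑ i ∈ s, b i • M i).map RatFunc.C =
          ∑ i ∈ s, (RatFunc.C (b i) : RatFunc Lb) • (M i).map RatFunc.C := by
        ext x y
        simp [Matrix.sum_apply]
      rw [this, Matrix.mul_sum]
      simp
    rw [e1]
    ext z w
    simp only [← hM, Matrix.sum_apply, Matrix.smul_apply, Matrix.map_apply, smul_eq_mul]
    have e2 : (1 : Matrix (Fin N) (Fin N) Lb).map RatFunc.C = (1 : Matrix _ _ (RatFunc Lb)) := by simp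
    rw [e2, Matrix.mul_one, hgsum z w]
    exact Finset.sum_congr rfl fun i _ => mul_comm _ _
  obtain ⟨z, hz⟩ : ∃ z : I → L, (∑ i ∈ s, algebraMap L Lb (z i) • M i).det ≠ 0 := by
    by_contra hcon
    push Not at hcon
    let P : MvPolynomial I Lb :=
      (∑ i ∈ s, (MvPolynomial.X i : MvPolynomial I Lb) • (M i).map MvPolynomial.C).det
    have hPe : ∀ x : I → Lb, MvPolynomial.eval x P = (∑ i ∈ s, x i • M i).det := by
      intro x
      rw [RingHom.map_det]
      congr 1
      ext p q
      simp [Matrix.sum_apply]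
    have hP0 : P = 0 := by
      refine MvPolynomial.funext_set (fun _ => Set.range (algebraMap L Lb))
        (fun _ => Set.infinite_range_of_injective (algebraMap L Lb).injective) ?_
      intro x hx
      rw [map_zero, hPe]
      have hx' : ∀ i, ∃ c, algebraMap L Lb c = x i := fun i => hx i (Set.mem_univ i)
      choose c hc using hx'
      simpa only [hc] using hcon c
    have := hPe (fun i => b i)
    rw [hP0, map_zero, hone, Matrix.det_one] at this
    exact zero_ne_one this
  have hMz : IsUnit (∑ i ∈ s, algebraMap L Lb (z i) • M i) := by
    rw [Matrix.isUnit_iff_isUnit_det, isUnit_iff_ne_zero]; exact hz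
  set Mz := ∑ i ∈ s, algebraMap L Lb (z i) • M i with hMzdef
  let G : Matrix (Fin N) (Fin N) (RatFunc L) := ∑ i ∈ s, (RatFunc.C (z i) : RatFunc L) • gc i
  have hG : G.map j = g * Mz.map RatFunc.C := by
    have e1 : G.map j = ∑ i ∈ s, (RatFunc.C (algebraMap L Lb (z i)) : RatFunc Lb) • (gc i).map j := by
      ext x y
      simp [G, Matrix.sum_apply, hj]
    have e2 : Mz.map RatFunc.C =
        ∑ i ∈ s, (RatFunc.C (algebraMap L Lb (z i)) : RatFunc Lb) • (M i).map RatFunc.C := by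
      ext x y
      simp only [hMzdef, Matrix.map_apply, Matrix.sum_apply, Matrix.smul_apply, map_sum, smul_eq_mul,
        map_mul]
    rw [e1, e2, Matrix.mul_sum]
    simp [hM]
  have hGu : IsUnit G := by
    apply isUnit_of_map j
    rw [hG]
    exact hg.mul (isUnit_map hMz _)
  refine ⟨G, hGu, ?_⟩
  intro σ
  obtain ⟨Ginv, hGinv⟩ := hGu.exists_left_inv
  obtain ⟨Minv, hMinv⟩ := hMz.exists_left_inv
  have hMinvu : IsUnit Minv := IsUnit.of_mul_eq_one _ hMinv
  set E := Minv * D σ * Mz with hE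
  have key : (Ginv * (f σ * G.map (ext φ σ))).map j = E.map RatFunc.C := by
    apply matrix_cancel (isUnit_map hGu j)
    rw [← Matrix.map_mul, ← Matrix.mul_assoc, mul_eq_one_comm.1 hGinv, Matrix.one_mul,
      Matrix.map_mul]
    have e3 : (G.map (ext φ σ)).map j = (G.map j).map (ext ((algebraMap L Lb).comp φ) σ) := by
      ext x y
      simp only [Matrix.map_apply]
      exact (ext_comp_bc φ (algebraMap L Lb) σ _).symm
    have e4 : (Mz.map RatFunc.C).map (ext ((algebraMap L Lb).comp φ) σ) = Mz.map RatFunc.C := by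
      ext x y
      simp
    rw [e3, hG, Matrix.map_mul, ← Matrix.mul_assoc, hD σ, e4, hE, Matrix.map_mul, Matrix.map_mul]
    have e5 : Mz.map RatFunc.C * Minv.map RatFunc.C = (1 : Matrix _ _ (RatFunc Lb)) := by
      rw [← Matrix.map_mul, mul_eq_one_comm.1 hMinv]; simp
    simp only [Matrix.mul_assoc]
    rw [← Matrix.mul_assoc (Mz.map RatFunc.C), e5, Matrix.one_mul]
  have hc : ∀ p q, ∃ c, (Ginv * (f σ * G.map (ext φ σ))) p q = RatFunc.C c := by
    intro p q
    refine bc_const (algebraMap L Lb) _ (E p q) ?_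
    exact congrFun (congrFun key p) q
  choose c hc using hc
  have hc' : (Matrix.of c).map RatFunc.C = Ginv * (f σ * G.map (ext φ σ)) := by
    ext p q; rw [hc]; rfl
  refine ⟨Matrix.of c, ?_, ?_⟩
  · apply isUnit_of_map (RatFunc.C)
    rw [hc']
    exact (IsUnit.of_mul_eq_one _ hGinv).mul ((hf σ).mul (isUnit_map hGu _))
  · rw [hc', ← Matrix.mul_assoc, mul_eq_one_comm.1 hGinv, Matrix.one_mul]

/-- One-variable statement over an arbitrary field extension. -/
lemma one_variable (k : Type) [Field k] [CharZero k] (N : ℕ) (l : ℕ) (hl : 2 ≤ l)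
    (Hj : Submonoid (RatFunc k →ₐ[k] RatFunc k))
    (hHe : ∃ e ∈ Hj, e RatFunc.X = RatFunc.X ^ l)
    (hloc : ∀ (Kb : Type) [Field Kb] [Algebra k Kb] [IsAlgClosed Kb],
      ∀ ι : RatFunc k →+* RatFunc Kb,
        (∀ c : k, ι (RatFunc.C c) = RatFunc.C (algebraMap k Kb c)) →
        ι RatFunc.X = RatFunc.X →
      ∀ ρ : (RatFunc k →ₐ[k] RatFunc k) → (RatFunc Kb →+* RatFunc Kb),
        (∀ σ ∈ Hj, ∀ τ ∈ Hj, ρ (σ * τ) = (ρ σ).comp (ρ τ)) →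
        (∀ σ ∈ Hj, ∀ c : Kb, ρ σ (RatFunc.C c) = RatFunc.C c) →
        (∀ σ ∈ Hj, ρ σ RatFunc.X = ι (σ RatFunc.X)) →
      ∀ f : (RatFunc k →ₐ[k] RatFunc k) → Matrix (Fin N) (Fin N) (RatFunc Kb),
        (∀ σ ∈ Hj, IsUnit (f σ)) →
        (∀ σ ∈ Hj, ∀ τ ∈ Hj, f (σ * τ) = f σ * (f τ).map (ρ σ)) →
        ∃ g : Matrix (Fin N) (Fin N) (RatFunc Kb), IsUnit g ∧
          ∀ σ ∈ Hj, ∃ C : Matrix (Fin N) (Fin N) Kb, IsUnit C ∧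
            f σ * g.map (ρ σ) = g * C.map RatFunc.C)
    (L : Type) [Field L] (φ : k →+* L)
    (f : Hj → Matrix (Fin N) (Fin N) (RatFunc L)) (hf : ∀ σ, IsUnit (f σ))
    (hfc : ∀ σ τ : Hj, f (σ * τ) = f σ * (f τ).map (ext φ σ)) :
    ∃ g : Matrix (Fin N) (Fin N) (RatFunc L), IsUnit g ∧ ∀ σ : Hj,
      ∃ C : Matrix (Fin N) (Fin N) L, IsUnit C ∧
        f σ * g.map (ext φ σ) = g * C.map RatFunc.C := by
  classical
  have : CharZero L := charZero_of_injective_ringHom φ.injective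
  obtain ⟨e, he, heX⟩ := hHe
  let Lb := AlgebraicClosure L
  let φb : k →+* Lb := (algebraMap L Lb).comp φ
  let algk : Algebra k Lb := φb.toAlgebra
  obtain ⟨g, hg, hgC⟩ := @hloc Lb _ algk _ (bc φb) (fun c => bc_C φb c) (bc_X φb) (fun σ => ext φb σ)
    (fun σ _ τ _ => ext_mul φb σ τ) (fun σ _ c => ext_C φb σ c) (fun σ _ => ext_X φb σ)
    (fun σ => if h : σ ∈ Hj then (f ⟨σ, h⟩).map (bc (algebraMap L Lb)) else 1)
    (by
      intro σ hσ
      simp only [hσ, dif_pos]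
      exact isUnit_map (hf _) _)
    (by
      intro σ hσ τ hτ
      simp only [hσ, hτ, Hj.mul_mem hσ hτ, dif_pos]
      have := hfc ⟨σ, hσ⟩ ⟨τ, hτ⟩
      rw [show (⟨σ * τ, Hj.mul_mem hσ hτ⟩ : Hj) = ⟨σ, hσ⟩ * ⟨τ, hτ⟩ from rfl, this, Matrix.map_mul]
      congr 1
      ext x y
      simp only [Matrix.map_apply]
      exact (ext_comp_bc φ (algebraMap L Lb) σ _).symm)
  refine descent (Lb := Lb) φ Hj l hl e he heX f hf g hg ?_
  rintro ⟨σ, hσ⟩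
  obtain ⟨C, hC, h⟩ := hgC σ hσ
  simp only [hσ, dif_pos] at h
  exact ⟨C, hC, h⟩

lemma twist {S F : Type*} [Monoid S] [Field F] {N : ℕ} (ρ : S → F →+* F)
    (hρ : ∀ σ τ, ρ (σ * τ) = (ρ σ).comp (ρ τ))
    (f f' : S → Matrix (Fin N) (Fin N) F) (hf : ∀ σ, IsUnit (f σ))
    (hfc : ∀ σ τ, f (σ * τ) = f σ * (f τ).map (ρ σ))
    (g : Matrix (Fin N) (Fin N) F) (hg : IsUnit g)
    (h : ∀ σ, f σ * g.map (ρ σ) = g * f' σ) :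
    (∀ σ, IsUnit (f' σ)) ∧ ∀ σ τ, f' (σ * τ) = f' σ * (f' τ).map (ρ σ) := by
  constructor
  · intro σ
    have h1 : IsUnit (g * f' σ) := by
      rw [← h]; exact (hf σ).mul (isUnit_map hg _)
    rw [Matrix.isUnit_iff_isUnit_det, Matrix.det_mul] at h1
    rw [Matrix.isUnit_iff_isUnit_det]
    exact isUnit_of_mul_isUnit_right h1
  · intro σ τ
    apply matrix_cancel hg
    rw [← h, hfc, hρ, ← Matrix.mul_assoc, ← h, Matrix.mul_assoc, Matrix.mul_assoc,
      ← Matrix.map_mul, ← h τ, Matrix.map_mul]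
    rfl

section
variable {K F : Type} [Field K] [Field F] [Algebra K F] {n : ℕ} (x : Fin n → F)

/-- The subfield generated by the variables in `T`. -/
abbrev E (T : Set (Fin n)) : IntermediateField K F := IntermediateField.adjoin K (x '' T)

lemma exists_theta (hx : AlgebraicIndependent K x) (T : Set (Fin n)) (i : Fin n) (hi : i ∉ T) :
    ∃ θ : RatFunc (E (K := K) x T) →+* F, (∀ c, θ (RatFunc.C c) = c) ∧ θ RatFunc.X = x i ∧
      ∀ y, y ∈ E (K := K) x (insert i T) ↔ ∃ r, θ r = y := by
  have htr : Transcendental (E (K := K) x T) (x i) := by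
    have h1 := hx.transcendental_adjoin hi
    exact fun h => h1 (IntermediateField.isAlgebraic_adjoin_iff.1 h)
  obtain ⟨θ, h1, h2⟩ := exists_lift (algebraMap (E (K := K) x T) F) (x i) (by
    intro p hp
    rw [transcendental_iff] at htr
    exact htr p hp)
  have h1' : ∀ c, θ (RatFunc.C c) = (c : F) := h1
  refine ⟨θ, h1', h2, ?_⟩
  intro y
  constructor
  · intro hy
    change y ∈ θ.fieldRange
    induction hy using IntermediateField.adjoin_induction with
    | mem y hy =>
      obtain ⟨m, hm, rfl⟩ := hy
      rcases hm with rfl | hm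
      · exact ⟨_, h2⟩
      · exact ⟨RatFunc.C ⟨x m, IntermediateField.subset_adjoin K _ ⟨m, hm, rfl⟩⟩, h1' _⟩
    | algebraMap c => exact ⟨RatFunc.C (algebraMap K _ c), h1' _⟩
    | add a b _ _ ha hb => exact Subfield.add_mem _ ha hb
    | inv a _ ha => exact Subfield.inv_mem _ ha
    | mul a b _ _ ha hb => exact Subfield.mul_mem _ ha hb
  · rintro ⟨r, rfl⟩
    refine ratFunc_mem_subfield ((E (K := K) x (insert i T)).toSubfield.comap θ) ?_ ?_ r
    · intro c
      change θ (RatFunc.C c) ∈ E (K := K) x (insert i T)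
      rw [h1']
      exact IntermediateField.adjoin.mono K _ _ (Set.image_mono (Set.subset_insert i T)) c.2
    · change θ RatFunc.X ∈ E (K := K) x (insert i T)
      rw [h2]
      exact IntermediateField.subset_adjoin K _ ⟨i, Set.mem_insert _ _, rfl⟩

end

section
variable {k K F : Type} [Field k] [Field K] [Field F] [Algebra K F] {n : ℕ} (x : Fin n → F)
  (φ : k →+* K) (ε : Fin n → RatFunc k →+* F)
  {H : Fin n → Submonoid (RatFunc k →ₐ[k] RatFunc k)}
  (ρ : (∀ j, H j) → F →+* F)

lemma rho_pres (hεC : ∀ j c, ε j (RatFunc.C c) = algebraMap K F (φ c))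
    (hεX : ∀ j, ε j RatFunc.X = x j)
    (hρK : ∀ σ c, ρ σ (algebraMap K F c) = algebraMap K F c)
    (hρx : ∀ σ j, ρ σ (x j) = ε j ((σ j : RatFunc k →ₐ[k] RatFunc k) RatFunc.X))
    (T : Set (Fin n)) (σ : ∀ j, H j) (y : F) (hy : y ∈ E (K := K) x T) :
    ρ σ y ∈ E (K := K) x T := by
  induction hy using IntermediateField.adjoin_induction with
  | mem y hy =>
    obtain ⟨m, hm, rfl⟩ := hy
    rw [hρx]
    refine ratFunc_mem_subfield ((E (K := K) x T).toSubfield.comap (ε m)) ?_ ?_ _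
    · intro c
      change ε m (RatFunc.C c) ∈ E (K := K) x T
      rw [hεC]
      exact IntermediateField.algebraMap_mem _ _
    · change ε m RatFunc.X ∈ E (K := K) x T
      rw [hεX]
      exact IntermediateField.subset_adjoin K _ ⟨m, hm, rfl⟩
  | algebraMap c => rw [hρK]; exact IntermediateField.algebraMap_mem _ _
  | add a b _ _ ha hb => rw [map_add]; exact add_mem ha hb
  | inv a _ ha => rw [map_inv₀]; exact inv_mem ha
  | mul a b _ _ ha hb => rw [map_mul]; exact mul_mem ha hb

lemma rho_fix (hεX : ∀ j, ε j RatFunc.X = x j)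
    (hρK : ∀ σ c, ρ σ (algebraMap K F c) = algebraMap K F c)
    (hρx : ∀ σ j, ρ σ (x j) = ε j ((σ j : RatFunc k →ₐ[k] RatFunc k) RatFunc.X))
    (T : Set (Fin n)) (σ : ∀ j, H j) (hσ : ∀ j ∈ T, σ j = 1) (y : F) (hy : y ∈ E (K := K) x T) :
    ρ σ y = y := by
  induction hy using IntermediateField.adjoin_induction with
  | mem y hy =>
    obtain ⟨m, hm, rfl⟩ := hy
    rw [hρx, hσ m hm]
    exact hεX m
  | algebraMap c => rw [hρK]
  | add a b _ _ ha hb => rw [map_add, ha, hb]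
  | inv a _ ha => rw [map_inv₀, ha]
  | mul a b _ _ ha hb => rw [map_mul, ha, hb]

lemma mul_entries {N : ℕ} (S : IntermediateField K F) {A B : Matrix (Fin N) (Fin N) F}
    (hA : ∀ p q, A p q ∈ S) (hB : ∀ p q, B p q ∈ S) (p q) : (A * B) p q ∈ S := by
  rw [Matrix.mul_apply]
  exact sum_mem fun r _ => mul_mem (hA _ _) (hB _ _)

set_option maxHeartbeats 1000000 in
lemma step (hx : AlgebraicIndependent K x)
    (hεC : ∀ j c, ε j (RatFunc.C c) = algebraMap K F (φ c))
    (hεX : ∀ j, ε j RatFunc.X = x j)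
    (hρ : ∀ σ τ, ρ (σ * τ) = (ρ σ).comp (ρ τ))
    (hρK : ∀ σ c, ρ σ (algebraMap K F c) = algebraMap K F c)
    (hρx : ∀ σ j, ρ σ (x j) = ε j ((σ j : RatFunc k →ₐ[k] RatFunc k) RatFunc.X))
    {N : ℕ} (i : Fin n) (l : ℕ) (hl : 2 ≤ l)
    (hHe : ∃ e ∈ H i, e RatFunc.X = RatFunc.X ^ l)
    (hone : ∀ (L : Type) [Field L] (φ : k →+* L)
      (f : H i → Matrix (Fin N) (Fin N) (RatFunc L)), (∀ σ, IsUnit (f σ)) →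
      (∀ σ τ : H i, f (σ * τ) = f σ * (f τ).map (ext φ σ)) →
      ∃ g : Matrix (Fin N) (Fin N) (RatFunc L), IsUnit g ∧ ∀ σ : H i,
        ∃ C : Matrix (Fin N) (Fin N) L, IsUnit C ∧
          f σ * g.map (ext φ σ) = g * C.map RatFunc.C)
    (T : Set (Fin n)) (hi : i ∉ T)
    (f : (∀ j, H j) → Matrix (Fin N) (Fin N) F) (hf : ∀ σ, IsUnit (f σ))
    (hfc : ∀ σ τ, f (σ * τ) = f σ * (f τ).map (ρ σ))
    (hfE : ∀ σ p q, f σ p q ∈ E (K := K) x (insert i T)) :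
    ∃ (g : Matrix (Fin N) (Fin N) F) (f' : (∀ j, H j) → Matrix (Fin N) (Fin N) F), IsUnit g ∧
      (∀ σ, f σ * g.map (ρ σ) = g * f' σ) ∧ ∀ σ p q, f' σ p q ∈ E (K := K) x T := by
  classical
  obtain ⟨e, he, heX⟩ := hHe
  obtain ⟨θ, hθC, hθX, hθr⟩ := exists_theta x hx T i hi
  have pres := rho_pres x φ ε ρ hεC hεX hρK hρx
  have fixes := rho_fix x ε ρ hεX hρK hρx
  let φ' : k →+* E (K := K) x T := (algebraMap K (E (K := K) x T)).comp φ
  have hθε : ∀ r, θ (bc φ' r) = ε i r := by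
    intro r
    have : θ.comp (bc φ') = ε i := by
      apply ratFunc_hom_ext
      · intro c
        rw [RingHom.comp_apply, bc_C, hθC, hεC]; rfl
      · rw [RingHom.comp_apply, bc_X, hθX, hεX]
    exact DFunLike.congr_fun this r
  have hcomm : ∀ (h : H i) r, ρ (Pi.mulSingle i h) (θ r) = θ (ext φ' h r) := by
    intro h r
    have : (ρ (Pi.mulSingle i h)).comp θ = θ.comp (ext φ' h) := by
      apply ratFunc_hom_ext
      · intro c
        rw [RingHom.comp_apply, RingHom.comp_apply, ext_C, hθC]
        refine fixes T _ ?_ _ c.2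
        intro j hj
        have hji : j ≠ i := by rintro rfl; exact hi hj
        exact Pi.mulSingle_eq_of_ne (M := fun j => H j) hji h
      · rw [RingHom.comp_apply, RingHom.comp_apply, ext_X, hθX, hθε, hρx, Pi.mulSingle_eq_same]
    exact DFunLike.congr_fun this r
  have hcommM : ∀ (h : H i) (v : Matrix (Fin N) (Fin N) (RatFunc (E (K := K) x T))),
      (v.map θ).map (ρ (Pi.mulSingle i h)) = (v.map (ext φ' h)).map θ := by
    intro h v
    ext p q
    exact hcomm h _
  have pull : ∀ A : Matrix (Fin N) (Fin N) F, (∀ p q, A p q ∈ E (K := K) x (insert i T)) →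
      ∃ v : Matrix (Fin N) (Fin N) (RatFunc (E (K := K) x T)), v.map θ = A := by
    intro A hA
    choose v hv using fun p q => (hθr _).1 (hA p q)
    exact ⟨Matrix.of v, by ext p q; exact hv p q⟩
  have pullC : ∀ A : Matrix (Fin N) (Fin N) F, (∀ p q, A p q ∈ E (K := K) x T) →
      ∃ v : Matrix (Fin N) (Fin N) (E (K := K) x T), (v.map RatFunc.C).map θ = A := by
    intro A hA
    exact ⟨Matrix.of fun p q => ⟨A p q, hA p q⟩, by ext p q; exact hθC _⟩
  have hθmem : ∀ (v : Matrix (Fin N) (Fin N) (RatFunc (E (K := K) x T))) p q,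
      v.map θ p q ∈ E (K := K) x (insert i T) := fun v p q => (hθr _).2 ⟨_, rfl⟩
  have hCmem : ∀ (v : Matrix (Fin N) (Fin N) (E (K := K) x T)) p q,
      (v.map RatFunc.C).map θ p q ∈ E (K := K) x T := by
    intro v p q
    have : (v.map RatFunc.C).map θ p q = v p q := hθC _
    rw [this]; exact (v p q).2
  choose u hu using fun h : H i => pull (f (Pi.mulSingle i h)) (hfE _)
  obtain ⟨G, hG, hGD⟩ := hone (E (K := K) x T) φ' u
    (fun h => isUnit_of_map θ (by rw [hu]; exact hf _))
    (by
      intro σ τ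
      apply map_inj θ
      rw [Matrix.map_mul, hu, hu, ← hcommM, hu, Pi.mulSingle_mul, hfc])
  choose D hDu hD using hGD
  obtain ⟨Ginv, hGinv⟩ := hG.exists_left_inv
  set g := G.map θ with hg
  have hgu : IsUnit g := isUnit_map hG θ
  have hgi : Ginv.map θ * g = 1 := by
    rw [hg, ← Matrix.map_mul, hGinv]; simp
  let f2 : (∀ j, H j) → Matrix (Fin N) (Fin N) F := fun σ => Ginv.map θ * (f σ * g.map (ρ σ))
  have hf2 : ∀ σ, f σ * g.map (ρ σ) = g * f2 σ := by
    intro σ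
    simp only [f2]
    rw [← Matrix.mul_assoc, mul_eq_one_comm.1 hgi, Matrix.one_mul]
  obtain ⟨hf2u, hf2c⟩ := twist ρ hρ f f2 hf hfc g hgu hf2
  have hf2E : ∀ σ p q, f2 σ p q ∈ E (K := K) x (insert i T) := by
    intro σ
    refine mul_entries _ (hθmem _) (mul_entries _ (hfE σ) ?_)
    intro p q
    exact pres _ σ _ (hθmem G p q)
  have hf2s : ∀ h : H i, f2 (Pi.mulSingle i h) = ((D h).map RatFunc.C).map θ := by
    intro h
    apply matrix_cancel hgu
    rw [← hf2, hg, hcommM, ← hu, ← Matrix.map_mul, hD, Matrix.map_mul]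
  have hf2T : ∀ σ : (∀ j, H j), σ i = 1 → ∀ p q, f2 σ p q ∈ E (K := K) x T := by
    intro σ hσ p q
    obtain ⟨v, hv⟩ := pull (f2 σ) (hf2E σ)
    have hconst : ∃ c, v p q = RatFunc.C c := by
      refine const_of_span _ (Set.range fun z : Fin N × Fin N => v z.1 z.2) (Set.finite_range _) ?_
      intro m
      let h : H i := ⟨e ^ m, (H i).pow_mem he m⟩
      refine ⟨l ^ m, (Nat.lt_pow_self hl).le, ext φ' h, fun c => ext_C _ _ c, ?_, ?_⟩
      · rw [ext_X]
        change bc _ ((e ^ m) RatFunc.X) = _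
        rw [pow_X e l heX, map_pow, bc_X]
      · have hcm : σ * Pi.mulSingle i h = Pi.mulSingle i h * σ := by
          funext j
          by_cases hj : j = i
          · subst hj; simp [hσ]
          · simp [Pi.mulSingle_eq_of_ne hj]
        have h1 := hf2c σ (Pi.mulSingle i h)
        rw [hcm, hf2c] at h1
        obtain ⟨W, hW⟩ := pullC ((f2 (Pi.mulSingle i h)).map (ρ σ)) (by
          intro p q
          refine pres _ σ _ ?_
          rw [hf2s]
          exact hCmem _ _ _)
        rw [← hW, hf2s, ← hv, hcommM, ← Matrix.map_mul, ← Matrix.map_mul] at h1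
        have h2 := map_inj θ h1
        obtain ⟨Dinv, hDinv⟩ := (hDu h).exists_left_inv
        have h3 : v.map (ext φ' h) = Dinv.map RatFunc.C * (v * W.map RatFunc.C) := by
          rw [← h2, ← Matrix.mul_assoc, ← Matrix.map_mul, hDinv]
          simp
        have h4 : ext φ' h (v p q) = v.map (ext φ' h) p q := rfl
        rw [h4, h3, Matrix.mul_apply]
        refine Submodule.sum_mem _ fun y _ => ?_
        rw [Matrix.map_apply, ← RatFunc.smul_eq_C_mul]
        refine Submodule.smul_mem _ _ ?_
        rw [Matrix.mul_apply]
        refine Submodule.sum_mem _ fun z _ => ?_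
        rw [Matrix.map_apply, mul_comm, ← RatFunc.smul_eq_C_mul]
        exact Submodule.smul_mem _ _ (Submodule.subset_span ⟨(y, z), rfl⟩)
    obtain ⟨c, hc⟩ := hconst
    rw [← hv, Matrix.map_apply, hc, hθC]
    exact c.2
  refine ⟨g, f2, hgu, hf2, ?_⟩
  intro σ
  have hσ : σ = Function.update σ i 1 * Pi.mulSingle i (σ i) := by
    funext j
    by_cases hj : j = i
    · subst hj; simp
    · simp [Pi.mulSingle_eq_of_ne hj, Function.update_of_ne hj]
  rw [hσ, hf2c]
  refine mul_entries _ (hf2T _ (by simp)) ?_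
  intro p q
  refine pres _ _ _ ?_
  rw [hf2s]
  exact hCmem _ _ _

lemma all_steps (hx : AlgebraicIndependent K x)
    (htop : E (K := K) x Set.univ = ⊤)
    (hεC : ∀ j c, ε j (RatFunc.C c) = algebraMap K F (φ c))
    (hεX : ∀ j, ε j RatFunc.X = x j)
    (hρ : ∀ σ τ, ρ (σ * τ) = (ρ σ).comp (ρ τ))
    (hρK : ∀ σ c, ρ σ (algebraMap K F c) = algebraMap K F c)
    (hρx : ∀ σ j, ρ σ (x j) = ε j ((σ j : RatFunc k →ₐ[k] RatFunc k) RatFunc.X))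
    {N : ℕ} (l : Fin n → ℕ) (hl : ∀ i, 2 ≤ l i)
    (hHe : ∀ i, ∃ e ∈ H i, e RatFunc.X = RatFunc.X ^ l i)
    (hone : ∀ (i : Fin n) (L : Type) [Field L] (φ : k →+* L)
      (f : H i → Matrix (Fin N) (Fin N) (RatFunc L)), (∀ σ, IsUnit (f σ)) →
      (∀ σ τ : H i, f (σ * τ) = f σ * (f τ).map (ext φ σ)) →
      ∃ g : Matrix (Fin N) (Fin N) (RatFunc L), IsUnit g ∧ ∀ σ : H i,
        ∃ C : Matrix (Fin N) (Fin N) L, IsUnit C ∧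
          f σ * g.map (ext φ σ) = g * C.map RatFunc.C)
    (f : (∀ j, H j) → Matrix (Fin N) (Fin N) F) (hf : ∀ σ, IsUnit (f σ))
    (hfc : ∀ σ τ, f (σ * τ) = f σ * (f τ).map (ρ σ)) :
    ∃ g : Matrix (Fin N) (Fin N) F, IsUnit g ∧ ∀ σ, ∃ C : Matrix (Fin N) (Fin N) K,
      IsUnit C ∧ f σ * g.map (ρ σ) = g * C.map (algebraMap K F) := by
  classical
  have main : ∀ S : Finset (Fin n), ∃ (g : Matrix (Fin N) (Fin N) F)
      (f' : (∀ j, H j) → Matrix (Fin N) (Fin N) F), IsUnit g ∧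
      (∀ σ, f σ * g.map (ρ σ) = g * f' σ) ∧
      ∀ σ p q, f' σ p q ∈ E (K := K) x {j | j ∉ S} := by
    intro S
    induction S using Finset.induction_on with
    | empty =>
      refine ⟨1, f, isUnit_one, fun σ => by simp, fun σ p q => ?_⟩
      have : {j : Fin n | j ∉ (∅ : Finset (Fin n))} = Set.univ := by ext; simp
      rw [this, htop]
      exact IntermediateField.mem_top
    | insert i S hi ih =>
      obtain ⟨g, f', hg, h, hE⟩ := ih
      obtain ⟨hu, hc⟩ := twist ρ hρ f f' hf hfc g hg h
      have hT : insert i {j | j ∉ insert i S} = {j | j ∉ S} := by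
        ext j
        by_cases hj : j = i
        · subst hj; simp [hi]
        · simp [hj]
      obtain ⟨g2, f2, hg2, h2, hE2⟩ := step x φ ε ρ hx hεC hεX hρ hρK hρx i (l i) (hl i) (hHe i)
        (hone i) {j | j ∉ insert i S} (by simp) f' hu hc (by rw [hT]; exact hE)
      refine ⟨g * g2, f2, hg.mul hg2, ?_, hE2⟩
      intro σ
      rw [Matrix.map_mul, ← Matrix.mul_assoc, h, Matrix.mul_assoc, h2, Matrix.mul_assoc]
  obtain ⟨g, f', hg, h, hE⟩ := main Finset.univ
  obtain ⟨hu, hc⟩ := twist ρ hρ f f' hf hfc g hg h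
  refine ⟨g, hg, fun σ => ?_⟩
  have hK : ∀ p q, ∃ c, algebraMap K F c = f' σ p q := by
    intro p q
    have h1 := hE σ p q
    have h2 : {j : Fin n | j ∉ (Finset.univ : Finset (Fin n))} = ∅ := by ext; simp
    rw [h2, E, Set.image_empty, IntermediateField.adjoin_empty, IntermediateField.mem_bot] at h1
    exact h1
  choose c hc' using hK
  have hcm : (Matrix.of c).map (algebraMap K F) = f' σ := by
    ext p q; exact hc' p q
  refine ⟨Matrix.of c, ?_, ?_⟩
  · apply isUnit_of_map (algebraMap K F)
    rw [hcm]; exact hu σ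
  · rw [hcm]; exact h σ
end

lemma adjoin_top (K : Type) [Field K] (n : ℕ) :
    E (K := K) (fun j : Fin n => algebraMap (MvPolynomial (Fin n) K)
      (FractionRing (MvPolynomial (Fin n) K)) (MvPolynomial.X j)) Set.univ = ⊤ := by
  rw [eq_top_iff]
  intro y _
  set S := E (K := K) (fun j : Fin n => algebraMap (MvPolynomial (Fin n) K)
      (FractionRing (MvPolynomial (Fin n) K)) (MvPolynomial.X j)) Set.univ
  have hp : ∀ p : MvPolynomial (Fin n) K,
      algebraMap _ (FractionRing (MvPolynomial (Fin n) K)) p ∈ S := by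
    intro p
    induction p using MvPolynomial.induction_on with
    | C a =>
      rw [← MvPolynomial.algebraMap_eq, ← IsScalarTower.algebraMap_apply]
      exact IntermediateField.algebraMap_mem _ _
    | add p q hp hq => rw [map_add]; exact add_mem hp hq
    | mul_X p i hp =>
      rw [map_mul]
      exact mul_mem hp (IntermediateField.subset_adjoin K _ ⟨i, Set.mem_univ _, rfl⟩)
  obtain ⟨a, b, _, rfl⟩ := IsFractionRing.div_surjective (A := MvPolynomial (Fin n) K) y
  exact div_mem (hp a) (hp b)

lemma algInd (K : Type) [Field K] (n : ℕ) :
    AlgebraicIndependent K (fun j : Fin n => algebraMap (MvPolynomial (Fin n) K)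
      (FractionRing (MvPolynomial (Fin n) K)) (MvPolynomial.X j)) :=
  (MvPolynomial.algebraicIndependent_X (Fin n) K).map'
    (f := IsScalarTower.toAlgHom K (MvPolynomial (Fin n) K) (FractionRing (MvPolynomial (Fin n) K)))
    (IsFractionRing.injective _ _)

end PCR

/-- **Reduction of `H¹(∏ Hⱼ, GL_N(K(x₁,…,xₙ)))` to the one-variable local problem.**
For each `j` let `Hⱼ` be a submonoid of the monoid of `k`-algebra endomorphisms of `k(t)`
containing `t ↦ t^{ℓⱼ}` (`ℓⱼ ≥ 2`).  Assume that for every algebraically closed extension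
`K̄` of `k` (with `k(t)` embedded in `K̄(t)` by `t ↦ t`, via `ι`), every `1`-cocycle of `Hⱼ`
with values in `GL_N(K̄(t))` (with respect to the extended action `ρ̄`) is cohomologous to
a cocycle with constant values in `GL_N(K̄)`.  Then for every extension `K` of `k`, with
`F = K(x₁,…,xₙ)` the fraction field of `MvPolynomial (Fin n) K`, every `1`-cocycle of
`∏ⱼ Hⱼ` with values in `GL_N(F)` — with respect to any action `ρ` where the `j`-th factor
acts through the variable `xⱼ` (encoded by the embeddings `ε j : k(t) → F`, `t ↦ xⱼ`) —
is cohomologous to a cocycle with constant values in `GL_N(K)`. -/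
theorem product_cocycle_reduction_to_local
    (k : Type) [Field k] [CharZero k] (N n : ℕ) (hN : 1 ≤ N) (hn : 1 ≤ n)
    (ℓ : Fin n → ℕ) (hℓ : ∀ j, 2 ≤ ℓ j)
    (H : Fin n → Submonoid (RatFunc k →ₐ[k] RatFunc k))
    (hHe : ∀ j, ∃ e ∈ H j, e RatFunc.X = RatFunc.X ^ ℓ j)
    (hloc : ∀ j : Fin n, ∀ (Kb : Type) [Field Kb] [Algebra k Kb] [IsAlgClosed Kb],
      ∀ ι : RatFunc k →+* RatFunc Kb,
        (∀ c : k, ι (RatFunc.C c) = RatFunc.C (algebraMap k Kb c)) →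
        ι RatFunc.X = RatFunc.X →
      ∀ ρ : (RatFunc k →ₐ[k] RatFunc k) → (RatFunc Kb →+* RatFunc Kb),
        (∀ σ ∈ H j, ∀ τ ∈ H j, ρ (σ * τ) = (ρ σ).comp (ρ τ)) →
        (∀ σ ∈ H j, ∀ c : Kb, ρ σ (RatFunc.C c) = RatFunc.C c) →
        (∀ σ ∈ H j, ρ σ RatFunc.X = ι (σ RatFunc.X)) →
      ∀ f : (RatFunc k →ₐ[k] RatFunc k) → Matrix (Fin N) (Fin N) (RatFunc Kb),
        (∀ σ ∈ H j, IsUnit (f σ)) →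
        (∀ σ ∈ H j, ∀ τ ∈ H j, f (σ * τ) = f σ * (f τ).map (ρ σ)) →
        ∃ g : Matrix (Fin N) (Fin N) (RatFunc Kb), IsUnit g ∧
          ∀ σ ∈ H j, ∃ C : Matrix (Fin N) (Fin N) Kb, IsUnit C ∧
            f σ * g.map (ρ σ) = g * C.map RatFunc.C) :
    ∀ (K : Type) [Field K] [Algebra k K],
      ∀ ε : Fin n → (RatFunc k →+* FractionRing (MvPolynomial (Fin n) K)),
        (∀ j, ∀ c : k, ε j (RatFunc.C c)
            = algebraMap K (FractionRing (MvPolynomial (Fin n) K)) (algebraMap k K c)) →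
        (∀ j, ε j RatFunc.X
            = algebraMap (MvPolynomial (Fin n) K) (FractionRing (MvPolynomial (Fin n) K))
                (MvPolynomial.X j)) →
      ∀ ρ : (∀ j, H j) → (FractionRing (MvPolynomial (Fin n) K) →+*
              FractionRing (MvPolynomial (Fin n) K)),
        (∀ σ τ, ρ (σ * τ) = (ρ σ).comp (ρ τ)) →
        (∀ σ, ∀ c : K, ρ σ (algebraMap K (FractionRing (MvPolynomial (Fin n) K)) c)
            = algebraMap K (FractionRing (MvPolynomial (Fin n) K)) c) →
        (∀ σ, ∀ j, ρ σ (algebraMap (MvPolynomial (Fin n) K)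
              (FractionRing (MvPolynomial (Fin n) K)) (MvPolynomial.X j))
            = ε j ((σ j : RatFunc k →ₐ[k] RatFunc k) RatFunc.X)) →
      ∀ f : (∀ j, H j) → Matrix (Fin N) (Fin N) (FractionRing (MvPolynomial (Fin n) K)),
        (∀ σ, IsUnit (f σ)) →
        (∀ σ τ, f (σ * τ) = f σ * (f τ).map (ρ σ)) →
        ∃ g : Matrix (Fin N) (Fin N) (FractionRing (MvPolynomial (Fin n) K)), IsUnit g ∧
          ∀ σ, ∃ C : Matrix (Fin N) (Fin N) K, IsUnit C ∧
            f σ * g.map (ρ σ) = g * C.map (algebraMap K (FractionRing (MvPolynomial (Fin n) K))) := by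
  intro K _ _ ε hεC hεX ρ hρ hρK hρx f hf hfc
  exact PCR.all_steps _ (algebraMap k K) ε ρ (PCR.algInd K n) (PCR.adjoin_top K n) hεC hεX hρ hρK
    hρx ℓ hℓ hHe (fun i L _ φ f hf hfc =>
      PCR.one_variable k N (ℓ i) (hℓ i) (H i) (hHe i) (hloc i) L φ f hf hfc) f hf hfc
end

section
/- Let k be a field of characteristic zero containing all ℓ-power roots of unity for some integer ℓ ≥ 2, and let H be the monoid of k-algebra endomorphisms of the rational function field k(x) of the form x ↦ λ·x^q with λ ∈ k^× and q ∈ ℤ∖{0} (so H ≅ k^× ⋊ ℤ_{≠0}). Let (f_σ) be a 1-cocycle on H with values in GL_N(k(x)), and suppose that for the element ξ : x ↦ x^ℓ both f_ξ and f_ξ^{-1} have all entries regular at x = 0 (lying in the local ring of k(x) at x = 0). Then (f_σ) is cohomologous to a 1-cocycle with constant values: there exists g ∈ GL_N(k(x)) such that g^{-1}·f_σ·σ(g) ∈ GL_N(k) for all σ ∈ H, i.e. the corresponding semi-linear representation is induced by a k-linear representation of H. -/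
namespace CocReg
open Polynomial

variable {k : Type} [Field k]

/-- Substitution `x ↦ c x` on polynomials. -/
noncomputable def sc (c : k) : k[X] →+* k[X] := compRingHom (C c * X)

lemma sc_apply (c : k) (p : k[X]) : sc c p = p.comp (C c * X) := rfl

lemma sc_sc (a b : k) (p : k[X]) : sc a (sc b p) = sc (a * b) p := by
  simp only [sc_apply, comp_assoc]
  congr 1
  simp only [mul_comp, C_comp, X_comp, C_mul]
  ring

lemma sc_one (p : k[X]) : sc 1 p = p := by simp [sc_apply]

lemma eval_sc (c a : k) (p : k[X]) : (sc c p).eval a = p.eval (c * a) := by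
  simp [sc_apply]

lemma aeval_sc {A : Type} [CommRing A] [Algebra k A] (c : k) (a : A) (p : k[X]) :
    aeval a (sc c p) = aeval (algebraMap k A c * a) p := by
  simp [sc_apply, aeval_comp]

/-- Two polynomials nonvanishing at zero are coprime after all but finitely many scalings. -/
lemma finite_bad (p q : k[X]) (hp : p.eval 0 ≠ 0) (hq : q.eval 0 ≠ 0) :
    {μ : k | ¬ IsCoprime p (sc μ q)}.Finite := by
  classical
  have hp0 : p ≠ 0 := by rintro rfl; simp at hp
  have hq0 : q ≠ 0 := by rintro rfl; simp at hq
  let A := AlgebraicClosure k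
  have hfin : (Set.image2 (fun b a : A => b / a) (q.rootSet A) (p.rootSet A)).Finite :=
    Set.Finite.image2 _ (q.rootSet_finite A) (p.rootSet_finite A)
  refine Set.Finite.subset (hfin.preimage (f := algebraMap k A)
    ((algebraMap k A).injective.injOn)) ?_
  intro μ hμ
  simp only [Set.mem_ofPred_eq] at hμ
  rw [isCoprime_iff_aeval_ne_zero_of_isAlgClosed k A] at hμ
  push Not at hμ
  obtain ⟨a, h1, h2⟩ := hμ
  rw [aeval_sc] at h2
  have ha : a ≠ 0 := by
    rintro rfl
    apply hp
    rw [← coeff_zero_eq_aeval_zero'] at h1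
    rw [← coeff_zero_eq_eval_zero]
    simpa using h1
  refine ⟨algebraMap k A μ * a, ?_, a, ?_, ?_⟩
  · rw [mem_rootSet]; exact ⟨hq0, h2⟩
  · rw [mem_rootSet]; exact ⟨hp0, h1⟩
  · exact mul_div_cancel_right₀ _ ha

lemma mem_of_coprime {I : Ideal k[X]} {a b c : k[X]} (hab : IsCoprime a b)
    (ha : c * a ∈ I) (hb : c * b ∈ I) : c ∈ I := by
  obtain ⟨u, v, h⟩ := hab
  have : c = u * (c * a) + v * (c * b) := by linear_combination (-c) * h
  rw [this]
  exact I.add_mem (I.mul_mem_left _ ha) (I.mul_mem_left _ hb)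

lemma sc_coprime {a b : k} (ha : a ≠ 0) {p q : k[X]} (h : IsCoprime p (sc (b / a) q)) :
    IsCoprime (sc a p) (sc b q) := by
  have := h.map (sc a)
  rwa [sc_sc, mul_div_cancel₀ _ ha] at this

lemma iter_mem {I : Ideal k[X]} {h : k[X]} {ζ c : k}
    (hop : ∀ p ∈ I, h * sc ζ h * sc c p ∈ I) (d : k[X]) (hd : d ∈ I) (n : ℕ) :
    (∏ i ∈ Finset.range n, sc (c ^ i) (h * sc ζ h)) * sc (c ^ n) d ∈ I := by
  induction n with
  | zero => simpa [sc_one] using hd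
  | succ n ih =>
    have := hop _ ih
    rw [Finset.prod_range_succ']
    simp only [map_mul, map_prod, sc_sc] at this ⊢
    simp only [pow_zero, sc_one, one_mul]
    convert this using 1
    simp only [pow_succ', mul_assoc]
    ring

lemma key_poly [CharZero k] {I : Ideal k[X]} {h : k[X]} {ζ : k} (hζ : ζ ≠ 0)
    (hop : ∀ p ∈ I, h * sc ζ h * sc 2 p ∈ I)
    (hop' : ∀ p ∈ I, h * sc ζ h * sc (2⁻¹) p ∈ I)
    (d : k[X]) (hd : d ∈ I) (hd0 : d.eval 0 ≠ 0) (m : ℕ)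
    (h1 : ∀ i, m ≤ i → IsCoprime h (sc ((2 : k) ^ i) h))
    (h2 : ∀ i : ℕ, IsCoprime h (sc ((2 : k) ^ i * ζ) h))
    (h3 : ∀ i : ℕ, IsCoprime h (sc ((2 : k) ^ i * ζ⁻¹) h)) :
    ∏ i ∈ Finset.range m, sc ((2 : k) ^ i) (h * sc ζ h) ∈ I := by
  have two : (2 : k) ≠ 0 := two_ne_zero
  have hinj : Function.Injective (fun n : ℕ => (2 : k) ^ n) := by
    intro a b hab
    have : ((2 ^ a : ℕ) : k) = ((2 ^ b : ℕ) : k) := by push_cast; exact hab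
    exact Nat.pow_right_injective le_rfl (Nat.cast_injective this)
  have hinj' : Function.Injective (fun n : ℕ => (2⁻¹ : k) ^ n) := by
    intro a b hab
    apply hinj
    simpa using hab
  have hF := finite_bad d d hd0 hd0
  have hbad := ((hF.preimage hinj.injOn).union (hF.preimage hinj'.injOn)).union
    (Set.finite_lt_nat m)
  obtain ⟨n, hn⟩ := hbad.exists_notMem
  simp only [Set.mem_union, Set.mem_preimage, Set.mem_ofPred_eq, not_or, not_not, not_lt] at hn
  obtain ⟨⟨hn1, hn2⟩, hnm⟩ := hn
  set e := h * sc ζ h with he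
  have hP : ∏ i ∈ Finset.range n, sc ((2 : k) ^ i) e ∈ I :=
    mem_of_coprime hn1 (I.mul_mem_left _ hd) (iter_mem hop d hd n)
  have hM : ∏ i ∈ Finset.range n, sc ((2⁻¹ : k) ^ i) e ∈ I :=
    mem_of_coprime hn2 (I.mul_mem_left _ hd) (iter_mem hop' d hd n)
  rw [← Finset.prod_range_mul_prod_Ico _ hnm] at hP
  refine mem_of_coprime ?_ hP (I.mul_mem_left _ hM)
  refine IsCoprime.prod_left fun i hi => IsCoprime.prod_right fun j hj => ?_
  have him := (Finset.mem_Ico.1 hi).1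
  -- coprimality of the scaled factors
  have hj0 : ((2⁻¹ : k) ^ j) ≠ 0 := by positivity
  rw [isCoprime_comm]
  have a1 : (2 : k) ^ i / (2⁻¹) ^ j = 2 ^ (i + j) := by
    rw [pow_add, inv_pow, div_inv_eq_mul]
  have hA : ∀ a b : k, a ≠ 0 → IsCoprime h (sc (b / a) h) → IsCoprime (sc a h) (sc b h) :=
    fun a b ha hh => sc_coprime ha hh
  simp only [he, map_mul, sc_sc]
  refine IsCoprime.mul_left (IsCoprime.mul_right ?_ ?_) (IsCoprime.mul_right ?_ ?_)
  · apply hA _ _ hj0; rw [a1]; exact h1 _ (by omega)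
  · apply hA _ _ hj0; rw [mul_div_right_comm, a1]; exact h2 _
  · apply hA _ _ (mul_ne_zero hj0 hζ); rw [← div_div, a1, div_eq_mul_inv]; exact h3 _
  · apply hA _ _ (mul_ne_zero hj0 hζ); rw [mul_div_mul_right _ _ hζ, a1]; exact h1 _ (by omega)


lemma exists_hom (t : RatFunc k) (ht : Transcendental k t) :
    ∃ σ : RatFunc k →ₐ[k] RatFunc k, σ RatFunc.X = t := by
  have hinj : Function.Injective (aeval t : k[X] →ₐ[k] RatFunc k) :=
    transcendental_iff_injective.1 ht
  refine ⟨RatFunc.liftAlgHom (aeval t) ?_, ?_⟩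
  · exact nonZeroDivisors_le_comap_nonZeroDivisors_of_injective _ hinj
  · have := RatFunc.liftAlgHom_apply_div (aeval t : k[X] →ₐ[k] RatFunc k)
      (nonZeroDivisors_le_comap_nonZeroDivisors_of_injective _ hinj) X 1
    simpa using this

lemma hom_alg (σ : RatFunc k →ₐ[k] RatFunc k) (p : k[X]) :
    σ (algebraMap k[X] (RatFunc k) p) = aeval (σ RatFunc.X) p := by
  rw [← RatFunc.aeval_X_left_eq_algebraMap, aeval_algHom_apply]

lemma hom_ext {σ τ : RatFunc k →ₐ[k] RatFunc k} (h : σ RatFunc.X = τ RatFunc.X) : σ = τ := by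
  ext r
  rw [← RatFunc.num_div_denom r, map_div₀, map_div₀]
  simp only [hom_alg, h]

lemma exists_scale {c : k} (hc : c ≠ 0) :
    ∃ σ : RatFunc k →ₐ[k] RatFunc k, σ RatFunc.X = c • RatFunc.X := by
  apply exists_hom
  intro h
  apply RatFunc.transcendental_X (K := k)
  have := (isAlgebraic_algebraMap (A := RatFunc k) c⁻¹).mul h
  rwa [Algebra.smul_def, ← mul_assoc, ← map_mul, inv_mul_cancel₀ hc, map_one, one_mul] at this

lemma exists_inv : ∃ σ : RatFunc k →ₐ[k] RatFunc k, σ RatFunc.X = RatFunc.X⁻¹ := by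
  apply exists_hom
  intro h
  apply RatFunc.transcendental_X (K := k)
  simpa using h.inv

lemma scale_alg {c : k} {σ : RatFunc k →ₐ[k] RatFunc k} (hσ : σ RatFunc.X = c • RatFunc.X)
    (p : k[X]) : σ (algebraMap k[X] (RatFunc k) p) = algebraMap _ _ (sc c p) := by
  rw [hom_alg, hσ, ← RatFunc.aeval_X_left_eq_algebraMap, aeval_sc, Algebra.smul_def]

variable {N : ℕ}

/-- Ideal of common denominators of a matrix. -/
def Dom (M : Matrix (Fin N) (Fin N) (RatFunc k)) : Ideal k[X] where
  carrier := {p | ∀ i j, ∃ P : k[X], algebraMap k[X] (RatFunc k) p * M i j = algebraMap _ _ P}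
  add_mem' := by
    intro a b ha hb i j
    obtain ⟨P, hP⟩ := ha i j
    obtain ⟨Q, hQ⟩ := hb i j
    exact ⟨P + Q, by rw [map_add, add_mul, hP, hQ, map_add]⟩
  zero_mem' := fun i j => ⟨0, by simp⟩
  smul_mem' := by
    intro c a ha i j
    obtain ⟨P, hP⟩ := ha i j
    exact ⟨c * P, by rw [smul_eq_mul, map_mul, mul_assoc, hP, map_mul]⟩

lemma mem_Dom {M : Matrix (Fin N) (Fin N) (RatFunc k)} {p : k[X]} : p ∈ Dom M ↔
    ∀ i j, ∃ P : k[X], algebraMap k[X] (RatFunc k) p * M i j = algebraMap _ _ P := Iff.rfl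

lemma denom_prod_mem (M : Matrix (Fin N) (Fin N) (RatFunc k)) :
    (∏ i, ∏ j, (M i j).denom) ∈ Dom M := by
  intro i j
  have h1 : (M i j).denom ∣ ∏ i, ∏ j, (M i j).denom :=
    (Finset.dvd_prod_of_mem (fun j => (M i j).denom) (Finset.mem_univ j)).trans
      (Finset.dvd_prod_of_mem (fun i => ∏ j, (M i j).denom) (Finset.mem_univ i))
  obtain ⟨Q, hQ⟩ := h1
  refine ⟨Q * (M i j).num, ?_⟩
  have h2 : algebraMap k[X] (RatFunc k) (M i j).denom ≠ 0 :=
    RatFunc.algebraMap_ne_zero (RatFunc.denom_ne_zero _)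
  have h3 := RatFunc.num_div_denom (M i j)
  rw [div_eq_iff h2] at h3
  rw [hQ, map_mul, map_mul, h3]
  ring

lemma exists_dom_ne_zero (M : Matrix (Fin N) (Fin N) (RatFunc k)) : ∃ p ∈ Dom M, p ≠ 0 :=
  ⟨_, denom_prod_mem M, Finset.prod_ne_zero_iff.2 fun _ _ => Finset.prod_ne_zero_iff.2
    fun _ _ => RatFunc.denom_ne_zero _⟩

lemma exists_dom_eval {M : Matrix (Fin N) (Fin N) (RatFunc k)}
    (hM : ∀ i j, eval 0 (M i j).denom ≠ 0) : ∃ p ∈ Dom M, p.eval 0 ≠ 0 := by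
  refine ⟨_, denom_prod_mem M, ?_⟩
  simp only [eval_prod]
  exact Finset.prod_ne_zero_iff.2 fun i _ => Finset.prod_ne_zero_iff.2 fun j _ => hM i j

lemma mul_mem_Dom {M M' : Matrix (Fin N) (Fin N) (RatFunc k)} {p q : k[X]}
    (hp : p ∈ Dom M) (hq : q ∈ Dom M') : p * q ∈ Dom (M * M') := by
  intro i j
  choose P hP using hp
  choose Q hQ using hq
  refine ⟨∑ l, P i l * Q l j, ?_⟩
  rw [Matrix.mul_apply, Finset.mul_sum, map_sum]
  refine Finset.sum_congr rfl fun l _ => ?_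
  rw [map_mul, map_mul, ← hP, ← hQ]
  ring

lemma sc_mem_Dom {M : Matrix (Fin N) (Fin N) (RatFunc k)} {p : k[X]}
    (hp : p ∈ Dom M) {c : k} {σ : RatFunc k →ₐ[k] RatFunc k}
    (hσ : σ RatFunc.X = c • RatFunc.X) : sc c p ∈ Dom (M.map σ) := by
  intro i j
  obtain ⟨P, hP⟩ := hp i j
  refine ⟨sc c P, ?_⟩
  rw [Matrix.map_apply, ← scale_alg hσ, ← scale_alg hσ, ← map_mul, hP]

/-- cancel powers of `X` -/
lemma X_pow_cancel {I : Ideal k[X]} {d p : k[X]} (hd : d ∈ I) (hd0 : d.eval 0 ≠ 0) (n : ℕ)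
    (h : p * X ^ n ∈ I) : p ∈ I := by
  refine mem_of_coprime (a := X ^ n) (b := d) ?_ h (I.mul_mem_left _ hd)
  apply IsCoprime.pow_left
  rw [(irreducible_X (R := k)).coprime_iff_not_dvd, X_dvd_iff, coeff_zero_eq_eval_zero]
  exact hd0

lemma exists_factor {e : k[X]} (he : e ≠ 0) : ∃ (a : ℕ) (h : k[X]), h.eval 0 ≠ 0 ∧
    e = X ^ a * h := by
  obtain ⟨q, h1, h2⟩ := exists_eq_pow_rootMultiplicity_mul_and_not_dvd e he 0
  refine ⟨_, q, ?_, by simpa using h1⟩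
  rwa [dvd_iff_isRoot] at h2

/-- The basic closure property. -/
lemma op_mem {F A B : Matrix (Fin N) (Fin N) (RatFunc k)} {h d : k[X]} {a : ℕ} {c ζ : k}
    (hζ : ζ ≠ 0) {σ τ : RatFunc k →ₐ[k] RatFunc k}
    (hσ : σ RatFunc.X = c • RatFunc.X) (hτ : τ RatFunc.X = ζ • RatFunc.X)
    (hA : X ^ a * h ∈ Dom A) (hB : X ^ a * h ∈ Dom B)
    (hF : F = A * F.map σ * B.map τ) (hd : d ∈ Dom F) (hd0 : d.eval 0 ≠ 0)
    (p : k[X]) (hp : p ∈ Dom F) : h * sc ζ h * sc c p ∈ Dom F := by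
  have h1 := mul_mem_Dom (mul_mem_Dom hA (sc_mem_Dom hp hσ)) (sc_mem_Dom hB hτ)
  rw [← hF] at h1
  apply X_pow_cancel hd hd0 (a + a)
  have h2 := (Dom F).mul_mem_left (C (ζ⁻¹ ^ a)) h1
  convert h2 using 1
  have h3 : sc ζ X = C ζ * X := by simp [sc_apply]
  have h4 : C (ζ⁻¹ ^ a) * C ζ ^ a = (1 : k[X]) := by
    rw [← C_pow, ← C_mul, ← mul_pow, inv_mul_cancel₀ hζ, one_pow, C_1]
  rw [map_mul (sc ζ), map_pow (sc ζ), h3, mul_pow, pow_add]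
  linear_combination (-(h * sc ζ h * sc c p * X ^ a * X ^ a)) * h4

open WithZero Classical in
lemma val_poly {p : k[X]} (hp : p ≠ 0) :
    RatFunc.inftyValuation k (algebraMap k[X] (RatFunc k) p) = exp (p.natDegree : ℤ) := by
  rw [RatFunc.inftyValuation_apply, RatFunc.inftyValuation.polynomial _ hp]

lemma natDegree_sc {c : k} (hc : c ≠ 0) (p : k[X]) : (sc c p).natDegree = p.natDegree := by
  rw [sc_apply, natDegree_comp, natDegree_C_mul_X _ hc, mul_one]

lemma sc_ne_zero {c : k} (hc : c ≠ 0) {p : k[X]} (hp : p ≠ 0) : sc c p ≠ 0 := by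
  intro h
  apply hp
  have := congrArg (sc c⁻¹) h
  rwa [sc_sc, inv_mul_cancel₀ hc, sc_one, map_zero] at this

open Classical in
lemma val_scale {c : k} (hc : c ≠ 0) {σ : RatFunc k →ₐ[k] RatFunc k}
    (hσ : σ RatFunc.X = c • RatFunc.X) (r : RatFunc k) :
    RatFunc.inftyValuation k (σ r) = RatFunc.inftyValuation k r := by
  have key : ∀ p : k[X], RatFunc.inftyValuation k (σ (algebraMap _ _ p)) =
      RatFunc.inftyValuation k (algebraMap _ _ p) := by
    intro p
    by_cases hp : p = 0
    · simp [hp]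
    · rw [scale_alg hσ, val_poly hp, val_poly (sc_ne_zero hc hp), natDegree_sc hc]
  rw [← RatFunc.num_div_denom r, map_div₀, map_div₀, map_div₀, key, key]

open WithZero Classical in
lemma val_inv {τ : RatFunc k →ₐ[k] RatFunc k} (hτ : τ RatFunc.X = RatFunc.X⁻¹)
    {r : RatFunc k} {p P : k[X]} (hp : p.eval 0 ≠ 0)
    (hr : algebraMap k[X] (RatFunc k) p * r = algebraMap _ _ P) :
    RatFunc.inftyValuation k (τ r) ≤ 1 := by
  set v := RatFunc.inftyValuation k with hv
  have hX : v (RatFunc.X⁻¹) < 1 := by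
    rw [map_inv₀, hv, RatFunc.inftyValuation.X, ← exp_neg, ← exp_zero, exp_lt_exp]
    norm_num
  have hC : ∀ a : k, a ≠ 0 → v (algebraMap k (RatFunc k) a) = 1 := fun a ha =>
    RatFunc.inftyValuation.C k ha
  have hC' : ∀ a : k, v (algebraMap k (RatFunc k) a) ≤ 1 := by
    intro a
    by_cases ha : a = 0
    · simp [ha]
    · exact (hC a ha).le
  have h1 : ∀ Q : k[X], v (τ (algebraMap _ _ Q)) ≤ 1 := by
    intro Q
    rw [hom_alg, hτ, aeval_eq_sum_range]
    refine v.map_sum_le fun i _ => ?_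
    rw [Algebra.smul_def, map_mul, map_pow]
    exact mul_le_one' (hC' _) (pow_le_one' hX.le _)
  have h2 : v (τ (algebraMap _ _ p)) = 1 := by
    have e : p = C (p.eval 0) + X * p.divX := by
      conv_lhs => rw [← divX_mul_X_add p]
      rw [coeff_zero_eq_eval_zero]
      ring
    have e2 : τ (algebraMap _ _ p) = algebraMap k (RatFunc k) (p.eval 0) +
        RatFunc.X⁻¹ * τ (algebraMap _ _ p.divX) := by
      conv_lhs => rw [e]
      rw [map_add, map_add, map_mul, map_mul, RatFunc.algebraMap_X, hτ, hom_alg, aeval_C]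
    rw [e2, v.map_add_eq_of_lt_left, hC _ hp]
    rw [hC _ hp, map_mul]
    exact mul_lt_one_of_lt_of_le hX (h1 _)
  have h3 := congrArg (fun z => v (τ z)) hr
  simp only [map_mul, h2, one_mul] at h3
  rw [h3]
  exact h1 P

open WithZero Classical in
lemma val_bound (T T' : Matrix (Fin N) (Fin N) (RatFunc k)) (D : k[X]) :
    ∃ d : ℕ, ∀ (ζ : k), ζ ≠ 0 → ∀ (σ τ : RatFunc k →ₐ[k] RatFunc k),
      σ RatFunc.X = ζ • RatFunc.X → τ RatFunc.X = RatFunc.X⁻¹ →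
      ∀ F G : Matrix (Fin N) (Fin N) (RatFunc k), F = T * G.map τ * T'.map σ →
      (∃ p ∈ Dom G, p.eval 0 ≠ 0) → ∀ i j (P : k[X]),
      algebraMap k[X] (RatFunc k) (D * sc ζ D) * F i j = algebraMap _ _ P → P.natDegree ≤ d := by
  set v := RatFunc.inftyValuation k with hv
  have hex : ∃ e : ℕ, (∀ i j, v (T i j) ≤ exp (e : ℤ)) ∧ (∀ i j, v (T' i j) ≤ exp (e : ℤ)) ∧
      v (algebraMap _ _ D) ≤ exp (e : ℤ) := by
    have hmono : ∀ r : RatFunc k, ∃ n : ℕ, ∀ e : ℕ, n ≤ e → v r ≤ exp (e : ℤ) := by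
      intro r
      by_cases hr : r = 0
      · exact ⟨0, fun e _ => by simp [hr]⟩
      · refine ⟨r.intDegree.toNat, fun e he => ?_⟩
        rw [hv, RatFunc.inftyValuation_apply, RatFunc.inftyValuation_of_nonzero _ hr, exp_le_exp]
        omega
    choose n hn using hmono
    refine ⟨(∑ i, ∑ j, n (T i j)) + (∑ i, ∑ j, n (T' i j)) + n (algebraMap _ _ D), ?_, ?_, ?_⟩
    · intro i j
      apply hn
      have h1 := Finset.single_le_sum (f := fun j => n (T i j)) (fun _ _ => Nat.zero_le _)
        (Finset.mem_univ j)
      have h2 := Finset.single_le_sum (f := fun i => ∑ j, n (T i j)) (fun _ _ => Nat.zero_le _)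
        (Finset.mem_univ i)
      omega
    · intro i j
      apply hn
      have h1 := Finset.single_le_sum (f := fun j => n (T' i j)) (fun _ _ => Nat.zero_le _)
        (Finset.mem_univ j)
      have h2 := Finset.single_le_sum (f := fun i => ∑ j, n (T' i j)) (fun _ _ => Nat.zero_le _)
        (Finset.mem_univ i)
      omega
    · apply hn
      omega
  obtain ⟨e, he1, he2, he3⟩ := hex
  refine ⟨e + e + (e + e), ?_⟩
  intro ζ hζ σ τ hσ hτ F G hF ⟨p, hp, hp0⟩ i j P hP
  have hG : ∀ a b, v (G.map τ a b) ≤ 1 := by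
    intro a b
    obtain ⟨Q, hQ⟩ := hp a b
    exact val_inv hτ hp0 hQ
  have hFv : v (F i j) ≤ exp (e : ℤ) * exp (e : ℤ) := by
    rw [hF, Matrix.mul_apply]
    refine v.map_sum_le fun b _ => ?_
    rw [map_mul]
    refine mul_le_mul' ?_ ?_
    · rw [Matrix.mul_apply]
      refine v.map_sum_le fun a _ => ?_
      rw [map_mul]
      calc _ ≤ exp (e : ℤ) * 1 := mul_le_mul' (he1 _ _) (hG _ _)
        _ = _ := mul_one _
    · rw [Matrix.map_apply, val_scale hζ hσ]
      exact he2 _ _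
  by_cases hP0 : P = 0
  · simp [hP0]
  have h1 := congrArg v hP
  rw [val_poly hP0, map_mul, map_mul, map_mul, ← scale_alg hσ, val_scale hζ hσ] at h1
  have h2 : exp (P.natDegree : ℤ) ≤ exp (e : ℤ) * exp (e : ℤ) * (exp (e : ℤ) * exp (e : ℤ)) := by
    rw [← h1]
    exact mul_le_mul' (mul_le_mul' he3 he3) hFv
  rw [← exp_add, ← exp_add, exp_le_exp] at h2
  omega

/-- The graph of the Taylor expansion at zero. -/
def Rel (k : Type) [Field k] : Subring (RatFunc k × PowerSeries k) where
  carrier := {x | ∃ q P : k[X], q.eval 0 ≠ 0 ∧ algebraMap k[X] (RatFunc k) q * x.1 = algebraMap _ _ P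
    ∧ (q : PowerSeries k) * x.2 = P}
  mul_mem' := by
    rintro a b ⟨q, P, h1, h2, h3⟩ ⟨q', P', h1', h2', h3'⟩
    refine ⟨q * q', P * P', by simp [h1, h1'], ?_, ?_⟩
    · rw [Prod.fst_mul, map_mul, map_mul, ← h2, ← h2']; ring
    · rw [Prod.snd_mul, coe_mul, coe_mul, ← h3, ← h3']; ring
  one_mem' := ⟨1, 1, by simp, by simp, by simp⟩
  add_mem' := by
    rintro a b ⟨q, P, h1, h2, h3⟩ ⟨q', P', h1', h2', h3'⟩
    refine ⟨q * q', q' * P + q * P', by simp [h1, h1'], ?_, ?_⟩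
    · rw [Prod.fst_add, map_mul, map_add, map_mul, map_mul, ← h2, ← h2']; ring
    · rw [Prod.snd_add, coe_add, coe_mul, coe_mul, coe_mul, ← h3, ← h3']; ring
  zero_mem' := ⟨1, 0, by simp, by simp, by simp⟩
  neg_mem' := by
    rintro a ⟨q, P, h1, h2, h3⟩
    refine ⟨q, -P, h1, ?_, ?_⟩
    · rw [Prod.fst_neg, mul_neg, h2, map_neg]
    · rw [Prod.snd_neg, mul_neg, h3, coe_neg]

lemma ne_zero_of_eval {q : k[X]} (h : q.eval 0 ≠ 0) : q ≠ 0 := by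
  rintro rfl; simp at h

lemma rel_unique {r r' : RatFunc k} {s s' : PowerSeries k} (h : (r, s) ∈ Rel k)
    (h' : (r', s') ∈ Rel k) : r = r' ↔ s = s' := by
  obtain ⟨q, P, h1, h2, h3⟩ := h
  obtain ⟨q', P', h1', h2', h3'⟩ := h'
  dsimp only at h2 h3 h2' h3'
  have a1 := RatFunc.algebraMap_ne_zero (ne_zero_of_eval h1)
  have a2 := RatFunc.algebraMap_ne_zero (ne_zero_of_eval h1')
  have b1 : (q : PowerSeries k) ≠ 0 := by simpa using ne_zero_of_eval h1
  have b2 : (q' : PowerSeries k) ≠ 0 := by simpa using ne_zero_of_eval h1'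
  have e1 : r = r' ↔ q' * P = q * P' := by
    rw [← (RatFunc.algebraMap_injective k).eq_iff, map_mul, map_mul, ← h2, ← h2']
    constructor
    · rintro rfl; ring
    · intro h
      apply mul_left_cancel₀ (mul_ne_zero a1 a2)
      linear_combination h
  have e2 : s = s' ↔ q' * P = q * P' := by
    rw [← Polynomial.coe_inj, coe_mul, coe_mul, ← h3, ← h3']
    constructor
    · rintro rfl; ring
    · intro h
      apply mul_left_cancel₀ (mul_ne_zero b1 b2)
      linear_combination h
  rw [e1, e2]

lemma rel_poly (p : k[X]) : (algebraMap k[X] (RatFunc k) p, (p : PowerSeries k)) ∈ Rel k :=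
  ⟨1, p, by simp, by simp, by simp⟩

lemma rel_exists {r : RatFunc k} {p P : k[X]} (hp : p.eval 0 ≠ 0)
    (h : algebraMap k[X] (RatFunc k) p * r = algebraMap _ _ P) : ∃ s, (r, s) ∈ Rel k := by
  refine ⟨(p : PowerSeries k)⁻¹ * P, p, P, hp, h, ?_⟩
  dsimp only
  rw [← mul_assoc, PowerSeries.mul_inv_cancel, one_mul]
  rw [Polynomial.constantCoeff_coe, coeff_zero_eq_eval_zero]
  exact hp

lemma rel_denom {r : RatFunc k} {s : PowerSeries k} (h : (r, s) ∈ Rel k) :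
    ∃ q P : k[X], q.eval 0 ≠ 0 ∧ algebraMap k[X] (RatFunc k) q * r = algebraMap _ _ P := by
  obtain ⟨q, P, h1, h2, h3⟩ := h
  exact ⟨q, P, h1, h2⟩

lemma rescale_coe (c : k) (p : k[X]) : PowerSeries.rescale c (p : PowerSeries k) = (sc c p : k[X]) := by
  ext n
  rw [PowerSeries.coeff_rescale, Polynomial.coeff_coe, Polynomial.coeff_coe, sc_apply,
    comp_C_mul_X_coeff, mul_comm]

lemma rel_scale {r : RatFunc k} {s : PowerSeries k} (h : (r, s) ∈ Rel k) {c : k}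
    {σ : RatFunc k →ₐ[k] RatFunc k} (hσ : σ RatFunc.X = c • RatFunc.X) :
    (σ r, PowerSeries.rescale c s) ∈ Rel k := by
  obtain ⟨q, P, h1, h2, h3⟩ := h
  refine ⟨sc c q, sc c P, by simpa [eval_sc] using h1, ?_, ?_⟩
  · dsimp only at h2 ⊢
    rw [← scale_alg hσ, ← scale_alg hσ, ← map_mul, h2]
  · dsimp only at h3 ⊢
    rw [← rescale_coe, ← rescale_coe, ← map_mul, h3]

lemma rel_expand {r : RatFunc k} {s : PowerSeries k} (h : (r, s) ∈ Rel k) {l : ℕ} (hl : l ≠ 0)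
    {ξ : RatFunc k →ₐ[k] RatFunc k} (hξ : ξ RatFunc.X = RatFunc.X ^ l) :
    (ξ r, PowerSeries.expand l hl s) ∈ Rel k := by
  have ha : ∀ p : k[X], ξ (algebraMap _ _ p) = algebraMap _ _ (Polynomial.expand k l p) := by
    intro p
    rw [hom_alg, hξ, ← RatFunc.aeval_X_left_eq_algebraMap, expand_aeval]
  have hb : ∀ p : k[X], PowerSeries.expand l hl (p : PowerSeries k) = (Polynomial.expand k l p : k[X]) := by
    intro p
    ext n
    rw [PowerSeries.coeff_expand, Polynomial.coeff_coe, Polynomial.coeff_coe,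
      Polynomial.coeff_expand (Nat.pos_of_ne_zero hl)]
  obtain ⟨q, P, h1, h2, h3⟩ := h
  refine ⟨Polynomial.expand k l q, Polynomial.expand k l P, by simpa [expand_eval, hl] using h1, ?_, ?_⟩
  · dsimp only at h2 ⊢
    rw [← ha, ← ha, ← map_mul, h2]
  · dsimp only at h3 ⊢
    rw [← hb, ← hb, ← map_mul, h3]

/-- Entrywise Taylor relation for matrices. -/
def RelM (M : Matrix (Fin N) (Fin N) (RatFunc k)) (S : Matrix (Fin N) (Fin N) (PowerSeries k)) :
    Prop := ∀ i j, (M i j, S i j) ∈ Rel k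

lemma RelM.mul {M M' : Matrix (Fin N) (Fin N) (RatFunc k)}
    {S S' : Matrix (Fin N) (Fin N) (PowerSeries k)} (h : RelM M S) (h' : RelM M' S') :
    RelM (M * M') (S * S') := by
  intro i j
  have := (Rel k).sum_mem (t := Finset.univ) fun l _ => (Rel k).mul_mem (h i l) (h' l j)
  rw [Matrix.mul_apply, Matrix.mul_apply]
  convert this using 1
  ext <;> simp [Prod.fst_sum, Prod.snd_sum]

lemma RelM.unique {M M' : Matrix (Fin N) (Fin N) (RatFunc k)}
    {S S' : Matrix (Fin N) (Fin N) (PowerSeries k)} (h : RelM M S) (h' : RelM M' S') :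
    M = M' ↔ S = S' := by
  rw [← Matrix.ext_iff, ← Matrix.ext_iff]
  exact forall_congr' fun i => forall_congr' fun j => rel_unique (h i j) (h' i j)

lemma RelM.one : RelM (1 : Matrix (Fin N) (Fin N) (RatFunc k)) 1 := by
  intro i j
  by_cases h : i = j
  · subst h; rw [Matrix.one_apply_eq, Matrix.one_apply_eq]; exact (Rel k).one_mem
  · rw [Matrix.one_apply_ne h, Matrix.one_apply_ne h]; exact (Rel k).zero_mem

lemma RelM.exists {M : Matrix (Fin N) (Fin N) (RatFunc k)} {p : k[X]} (hp : p.eval 0 ≠ 0)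
    (h : p ∈ Dom M) : ∃ S, RelM M S := by
  have : ∀ i j, ∃ s, (M i j, s) ∈ Rel k := fun i j => by
    obtain ⟨P, hP⟩ := h i j
    exact rel_exists hp hP
  choose S hS using this
  exact ⟨S, hS⟩

lemma RelM.dom {M : Matrix (Fin N) (Fin N) (RatFunc k)}
    {S : Matrix (Fin N) (Fin N) (PowerSeries k)} (h : RelM M S) :
    ∃ p ∈ Dom M, p.eval 0 ≠ 0 := by
  apply (fun h => exists_dom_eval h)
  intro i j
  obtain ⟨q, P, h1, h2⟩ := rel_denom (h i j)
  have hq := ne_zero_of_eval h1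
  have : (M i j).denom ∣ q := by
    rw [RatFunc.denom_dvd hq]
    refine ⟨P, ?_⟩
    rw [← h2, mul_div_cancel_left₀ _ (RatFunc.algebraMap_ne_zero hq)]
  intro h0
  exact h1 (eval_eq_zero_of_dvd_of_eval_eq_zero this h0)

lemma map_mul' {R S F : Type} [CommRing R] [CommRing S] [FunLike F R S] [RingHomClass F R S] (φ : F)
    (M M' : Matrix (Fin N) (Fin N) R) :
    (M * M').map φ = M.map φ * M'.map φ := by
  ext i j
  simp [Matrix.mul_apply, map_sum, map_mul]

lemma map_one' {R S F : Type} [CommRing R] [CommRing S] [FunLike F R S] [RingHomClass F R S] (φ : F) :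
    (1 : Matrix (Fin N) (Fin N) R).map φ = 1 := by
  ext i j
  simp [Matrix.one_apply, apply_ite φ]

/-- Coefficients of the formal gauge transformation. -/
noncomputable def gc (A : ℕ → Matrix (Fin N) (Fin N) k) (B : Matrix (Fin N) (Fin N) k) (l : ℕ)
    (hl : 2 ≤ l) (n : ℕ) : Matrix (Fin N) (Fin N) k :=
  if hn : n = 0 then 1 else
    (∑ x ∈ (Finset.HasAntidiagonal.antidiagonal n).attach,
      A x.1.1 * (if l ∣ x.1.2 then gc A B l hl (x.1.2 / l) else 0)) * B
termination_by n
decreasing_by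
  have := Finset.HasAntidiagonal.mem_antidiagonal.1 x.2
  calc x.1.2 / l ≤ n / l := Nat.div_le_div_right (by omega)
    _ < n := Nat.div_lt_self (by omega) (by omega)

lemma gc_eq (A : ℕ → Matrix (Fin N) (Fin N) k) (B : Matrix (Fin N) (Fin N) k) (l : ℕ)
    (hl : 2 ≤ l) (hAB : A 0 * B = 1) (n : ℕ) :
    gc A B l hl n = (∑ x ∈ Finset.HasAntidiagonal.antidiagonal n,
      A x.1 * (if l ∣ x.2 then gc A B l hl (x.2 / l) else 0)) * B := by
  by_cases hn : n = 0
  · subst hn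
    have h0 : gc A B l hl 0 = 1 := by rw [gc]; simp
    simp [h0, hAB]
  · rw [gc, dif_neg hn, Finset.sum_attach (Finset.HasAntidiagonal.antidiagonal n)
      (fun x => A x.1 * (if l ∣ x.2 then gc A B l hl (x.2 / l) else 0))]

lemma exists_gauge (A B : Matrix (Fin N) (Fin N) (PowerSeries k)) (hAB : A * B = 1) (l : ℕ)
    (hl : 2 ≤ l) : ∃ (g gi : Matrix (Fin N) (Fin N) (PowerSeries k))
      (B0 : Matrix (Fin N) (Fin N) (PowerSeries k)),
      (∀ c : k, B0.map (PowerSeries.rescale c) = B0) ∧ g * gi = 1 ∧ gi * g = 1 ∧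
      g.map PowerSeries.constantCoeff = 1 ∧ gi.map PowerSeries.constantCoeff = 1 ∧
      g = A * g.map (PowerSeries.expand l (by omega)) * B0 := by
  set A' : ℕ → Matrix (Fin N) (Fin N) k := fun n => A.map (PowerSeries.coeff n) with hA'
  set B' : Matrix (Fin N) (Fin N) k := B.map PowerSeries.constantCoeff with hB'
  have hAB' : A' 0 * B' = 1 := by
    have := congrArg (fun M : Matrix (Fin N) (Fin N) (PowerSeries k) =>
      M.map PowerSeries.constantCoeff) hAB
    simp only [map_mul', map_one'] at this
    rw [← this, hA', hB']
    congr 1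
    ext i j
    simp
  set g : Matrix (Fin N) (Fin N) (PowerSeries k) :=
    Matrix.of fun i j => PowerSeries.mk fun n => gc A' B' l hl n i j with hg
  have hgc : g.map PowerSeries.constantCoeff = 1 := by
    ext i j
    have h0 : gc A' B' l hl 0 = 1 := by rw [gc]; simp
    rw [Matrix.map_apply, hg, Matrix.of_apply, ← PowerSeries.coeff_zero_eq_constantCoeff_apply,
      PowerSeries.coeff_mk, h0]
  have hdet : IsUnit g.det := by
    rw [PowerSeries.isUnit_iff_constantCoeff, RingHom.map_det, RingHom.mapMatrix_apply, hgc]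
    simp
  have hgg : g * g⁻¹ = 1 := Matrix.mul_nonsing_inv _ hdet
  refine ⟨g, g⁻¹, B'.map PowerSeries.C, ?_, hgg, Matrix.nonsing_inv_mul _ hdet, hgc, ?_, ?_⟩
  · intro c
    ext i j n
    rw [Matrix.map_apply, Matrix.map_apply, PowerSeries.coeff_rescale, PowerSeries.coeff_C]
    split_ifs with h
    · simp [h]
    · simp
  · have := congrArg (fun M : Matrix (Fin N) (Fin N) (PowerSeries k) =>
      M.map PowerSeries.constantCoeff) hgg
    simpa only [map_mul', map_one', hgc, one_mul] using this
  · ext i j n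
    have h1 : PowerSeries.coeff n (g i j) = gc A' B' l hl n i j := by
      rw [hg, Matrix.of_apply, PowerSeries.coeff_mk]
    rw [h1, gc_eq _ _ _ _ hAB', Matrix.mul_apply, Matrix.mul_apply, map_sum]
    refine Finset.sum_congr rfl fun b _ => ?_
    rw [Matrix.map_apply, PowerSeries.coeff_mul_C, Matrix.mul_apply, map_sum, Matrix.sum_apply]
    congr 1
    simp only [PowerSeries.coeff_mul]
    rw [Finset.sum_comm]
    refine Finset.sum_congr rfl fun x _ => ?_
    rw [Matrix.mul_apply]
    refine Finset.sum_congr rfl fun a _ => ?_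
    rw [Matrix.map_apply, PowerSeries.coeff_expand]
    simp only [hA', Matrix.map_apply]
    congr 1
    split_ifs with h
    · rw [hg, Matrix.of_apply, PowerSeries.coeff_mk]
    · rfl

/-- The rigidity step: bounded degree for infinitely many scalings forces polynomiality. -/
lemma rigid (G E : Matrix (Fin N) (Fin N) (PowerSeries k)) (Z : Set k) (hZ : Z.Infinite) (d : ℕ)
    (h : ∀ ζ ∈ Z, ∀ i j n, d < n →
      PowerSeries.coeff n ((G * E.map (PowerSeries.rescale ζ)) i j) = 0)
    (i j : Fin N) (a b : ℕ) (hab : d < a + b) :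
    ∑ t, PowerSeries.coeff a (G i t) * PowerSeries.coeff b (E t j) = 0 := by
  set Q : k[X] := ∑ x ∈ Finset.HasAntidiagonal.antidiagonal (a + b),
    C (∑ t, PowerSeries.coeff x.1 (G i t) * PowerSeries.coeff x.2 (E t j)) * X ^ x.2 with hQ
  have hQ0 : Q = 0 := by
    apply Polynomial.eq_zero_of_infinite_isRoot
    refine hZ.mono fun ζ hζ => ?_
    have := h ζ hζ i j (a + b) hab
    rw [Matrix.mul_apply, map_sum] at this
    simp only [PowerSeries.coeff_mul, Matrix.map_apply, PowerSeries.coeff_rescale] at this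
    rw [Finset.sum_comm] at this
    rw [Set.mem_ofPred_eq, IsRoot.def, hQ, eval_finsetSum, ← this]
    refine Finset.sum_congr rfl fun x _ => ?_
    rw [eval_mul, eval_C, eval_pow, eval_X, Finset.sum_mul]
    refine Finset.sum_congr rfl fun t _ => ?_
    ring
  have h1 := congrArg (fun p => coeff p b) hQ0
  simp only [hQ, finsetSum_coeff, coeff_C_mul_X_pow, coeff_zero] at h1
  rw [Finset.sum_eq_single (a, b)] at h1
  · simpa using h1
  · rintro ⟨x, y⟩ hx hne
    rw [if_neg]
    rintro rfl
    apply hne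
    have := Finset.HasAntidiagonal.mem_antidiagonal.1 hx
    ext
    · dsimp only at this ⊢; omega
    · rfl
  · intro hh
    exact (hh (Finset.HasAntidiagonal.mem_antidiagonal.2 rfl)).elim

/-- A power series with bounded support after multiplication by `D` is rational. -/
lemma rel_of_bounded {D : k[X]} (hD : D.eval 0 ≠ 0) {s : PowerSeries k} {d : ℕ}
    (h : ∀ n, d < n → PowerSeries.coeff n ((D : PowerSeries k) * s) = 0) :
    ∃ r, (r, s) ∈ Rel k := by
  set P : k[X] := PowerSeries.trunc (d + 1) ((D : PowerSeries k) * s) with hP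
  refine ⟨algebraMap _ _ P / algebraMap _ _ D, D, P, hD, ?_, ?_⟩
  · exact mul_div_cancel₀ _ (RatFunc.algebraMap_ne_zero (ne_zero_of_eval hD))
  · dsimp only
    ext n
    rw [Polynomial.coeff_coe, hP, PowerSeries.coeff_trunc]
    split_ifs with hn
    · rfl
    · exact h n (by omega)

/-- A rational function invariant under infinitely many scalings is constant. -/
lemma const_of_inv [CharZero k] (r : RatFunc k) (Z : Set k) (hZ : Z.Infinite)
    (h : ∀ ζ ∈ Z, ∃ σ : RatFunc k →ₐ[k] RatFunc k, σ RatFunc.X = ζ • RatFunc.X ∧ σ r = r) :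
    ∃ c : k, r = algebraMap k (RatFunc k) c := by
  have hd := RatFunc.denom_ne_zero r
  obtain ⟨c, hc⟩ : ∃ c : k, c ∉ {c : k | (X * r.denom).IsRoot c} := by
    apply Set.Finite.exists_notMem
    by_contra hinf
    exact mul_ne_zero X_ne_zero hd (eq_zero_of_infinite_isRoot _ hinf)
  simp only [Set.mem_ofPred_eq, IsRoot.def, eval_mul, eval_X, mul_eq_zero, not_or] at hc
  obtain ⟨hc0, hc1⟩ := hc
  have hda := RatFunc.algebraMap_ne_zero hd
  have hr := RatFunc.num_div_denom r
  rw [div_eq_iff hda] at hr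
  have key : C (r.denom.eval c) * r.num - C (r.num.eval c) * r.denom = 0 := by
    apply eq_zero_of_infinite_isRoot
    have hinj : Function.Injective (fun ζ : k => ζ * c) := mul_left_injective₀ hc0
    refine (hZ.image hinj.injOn).mono ?_
    rintro _ ⟨ζ, hζ, rfl⟩
    obtain ⟨σ, hσ, hσr⟩ := h ζ hζ
    have h1 := congrArg σ hr
    rw [map_mul, hσr, scale_alg hσ, scale_alg hσ] at h1
    have h2 : sc ζ r.num * r.denom = sc ζ r.denom * r.num := by
      apply RatFunc.algebraMap_injective k
      rw [map_mul, map_mul, h1, hr]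
      ring
    have h3 := congrArg (eval c) h2
    simp only [eval_mul, eval_sc] at h3
    simp only [Set.mem_ofPred_eq, IsRoot.def, eval_sub, eval_mul, eval_C]
    linear_combination h3
  refine ⟨r.num.eval c / r.denom.eval c, ?_⟩
  apply mul_right_cancel₀ hda
  rw [← hr]
  have h4 : r.num = C (r.num.eval c / r.denom.eval c) * r.denom := by
    rw [div_eq_mul_inv, C_mul]
    have : C (r.denom.eval c) * C (r.denom.eval c)⁻¹ = (1 : k[X]) := by
      rw [← C_mul, mul_inv_cancel₀ hc1, C_1]
    linear_combination C (r.denom.eval c)⁻¹ * key - r.num * this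
  conv_lhs => rw [h4]
  rw [map_mul, RatFunc.algebraMap_C, RatFunc.algebraMap_eq_C]

lemma rescale_expand (ζ : k) (l : ℕ) (hl : l ≠ 0) (s : PowerSeries k) :
    PowerSeries.rescale ζ (PowerSeries.expand l hl s) =
      PowerSeries.expand l hl (PowerSeries.rescale (ζ ^ l) s) := by
  ext n
  rw [PowerSeries.coeff_rescale, PowerSeries.coeff_expand, PowerSeries.coeff_expand]
  split_ifs with h
  · obtain ⟨m, rfl⟩ := h
    rw [PowerSeries.coeff_rescale, Nat.mul_div_cancel_left _ (Nat.pos_of_ne_zero hl), ← pow_mul]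
  · simp

/-- Roots of unity of `l`-power order. -/
def Mu (k : Type) [Field k] (l : ℕ) : Set k := {ζ | ∃ m : ℕ, ζ ^ (l ^ m) = 1}

lemma Mu_ne_zero {l : ℕ} (hl : 2 ≤ l) {ζ : k} (h : ζ ∈ Mu k l) : ζ ≠ 0 := by
  rintro rfl
  obtain ⟨m, hm⟩ := h
  have : l ^ m ≠ 0 := by positivity
  rw [zero_pow this] at hm
  exact zero_ne_one hm

lemma Mu_inv {l : ℕ} {ζ : k} (h : ζ ∈ Mu k l) : ζ⁻¹ ∈ Mu k l := by
  obtain ⟨m, hm⟩ := h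
  exact ⟨m, by rw [inv_pow, hm, inv_one]⟩

lemma Mu_zpow {l : ℕ} {ζ : k} (h : ζ ∈ Mu k l) (q : ℤ) : ζ ^ q ∈ Mu k l := by
  obtain ⟨m, hm⟩ := h
  exact ⟨m, by rw [← zpow_natCast, ← zpow_mul, mul_comm, zpow_mul, zpow_natCast, hm, one_zpow]⟩

lemma Mu_infinite {l : ℕ} (hl : 2 ≤ l) (hroots : ∀ m : ℕ, ∃ ζ : k, IsPrimitiveRoot ζ (l ^ m)) :
    (Mu k l).Infinite := by
  choose z hz using hroots
  refine Set.infinite_of_injective_forall_mem (f := z) ?_ fun m => ⟨m, (hz m).pow_eq_one⟩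
  intro a b hab
  have h1 := hz a
  rw [hab] at h1
  exact Nat.pow_right_injective hl (h1.unique (hz b))

lemma Mu_good_aux [CharZero k] {l : ℕ} (hl : 2 ≤ l) (F : Set k) (hF : F.Finite) :
    {ζ ∈ Mu k l | ∃ i : ℕ, (2 : k) ^ i * ζ ∈ F}.Finite := by
  have : {ζ ∈ Mu k l | ∃ i : ℕ, (2 : k) ^ i * ζ ∈ F} ⊆
      ⋃ μ ∈ F, {ζ ∈ Mu k l | ∃ i : ℕ, (2 : k) ^ i * ζ = μ} := by
    rintro ζ ⟨h1, i, h2⟩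
    simp only [Set.mem_iUnion]
    exact ⟨_, h2, h1, i, rfl⟩
  refine Set.Finite.subset (hF.biUnion fun μ _ => Set.Subsingleton.finite ?_) this
  rintro ζ ⟨⟨a, ha⟩, i, hi⟩ ζ' ⟨⟨b, hb⟩, j, hj⟩
  have e : (2 : k) ^ i * ζ = 2 ^ j * ζ' := hi.trans hj.symm
  have e2 := congrArg (fun x => x ^ (l ^ a * l ^ b)) e
  have ha' : ζ ^ (l ^ a * l ^ b) = 1 := by rw [pow_mul, ha, one_pow]
  have hb' : ζ' ^ (l ^ a * l ^ b) = 1 := by rw [mul_comm, pow_mul, hb, one_pow]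
  simp only [mul_pow, ha', hb', mul_one, ← pow_mul] at e2
  have e3 : ((2 ^ (i * (l ^ a * l ^ b)) : ℕ) : k) = ((2 ^ (j * (l ^ a * l ^ b)) : ℕ) : k) := by
    push_cast; exact e2
  have e4 := Nat.pow_right_injective le_rfl (Nat.cast_injective e3)
  have hpos : 0 < l ^ a * l ^ b := by positivity
  have e5 : i = j := Nat.eq_of_mul_eq_mul_right hpos e4
  subst e5
  exact mul_left_cancel₀ (pow_ne_zero _ two_ne_zero) e

lemma Mu_good [CharZero k] {l : ℕ} (hl : 2 ≤ l)
    (hroots : ∀ m : ℕ, ∃ ζ : k, IsPrimitiveRoot ζ (l ^ m)) (F : Set k) (hF : F.Finite) :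
    {ζ ∈ Mu k l | ∀ i : ℕ, (2 : k) ^ i * ζ ∉ F ∧ (2 : k) ^ i * ζ⁻¹ ∉ F}.Infinite := by
  have h1 := Mu_good_aux hl F hF
  have h2 := h1.preimage (f := fun x : k => x⁻¹) inv_injective.injOn
  refine ((Mu_infinite hl hroots).sdiff (h1.union h2)).mono ?_
  rintro ζ ⟨hζ, hn⟩
  rw [Set.mem_union, not_or] at hn
  refine ⟨hζ, fun i => ⟨fun h => hn.1 ⟨hζ, i, h⟩, fun h => hn.2 ⟨Mu_inv hζ, i, h⟩⟩⟩

end CocReg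

open CocReg Polynomial in
theorem cocycle_regular_at_zero_is_constant
    (k : Type) [Field k] [CharZero k] (N : ℕ) (hN : 1 ≤ N)
    (ℓ : ℕ) (hℓ : 2 ≤ ℓ) (hroots : ∀ m : ℕ, ∃ ζ : k, IsPrimitiveRoot ζ (ℓ ^ m))
    (Hset : Set (RatFunc k →ₐ[k] RatFunc k))
    (hHdef : Hset = {σ : RatFunc k →ₐ[k] RatFunc k |
      ∃ (lam : kˣ) (q : ℤ), q ≠ 0 ∧ σ RatFunc.X = (lam : k) • RatFunc.X ^ q})
    (f : (RatFunc k →ₐ[k] RatFunc k) → Matrix (Fin N) (Fin N) (RatFunc k))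
    (hfu : ∀ σ ∈ Hset, IsUnit (f σ))
    (hcoc : ∀ σ ∈ Hset, ∀ τ ∈ Hset, f (σ * τ) = f σ * (f τ).map ⇑σ)
    (ξ : RatFunc k →ₐ[k] RatFunc k) (hξ : ξ RatFunc.X = RatFunc.X ^ ℓ)
    (B : Matrix (Fin N) (Fin N) (RatFunc k))
    (hB : f ξ * B = 1 ∧ B * f ξ = 1)
    (hreg : ∀ i j, Polynomial.eval 0 (f ξ i j).denom ≠ 0 ∧
      Polynomial.eval 0 (B i j).denom ≠ 0) :
    ∃ g : Matrix (Fin N) (Fin N) (RatFunc k), IsUnit g ∧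
      ∀ σ ∈ Hset, ∃ C : Matrix (Fin N) (Fin N) k, IsUnit C ∧
        f σ * g.map ⇑σ = g * C.map (algebraMap k (RatFunc k)) := by
  have hl0 : ℓ ≠ 0 := by omega
  -- the scalings and the inversion
  have hS : ∀ c : k, ∃ σ : RatFunc k →ₐ[k] RatFunc k, c ≠ 0 → σ RatFunc.X = c • RatFunc.X := by
    intro c
    by_cases hc : c = 0
    · exact ⟨AlgHom.id k _, fun h => absurd hc h⟩
    · obtain ⟨σ, hσ⟩ := exists_scale hc
      exact ⟨σ, fun _ => hσ⟩
  choose S hS using hS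
  obtain ⟨τ, hτ⟩ := exists_inv (k := k)
  have hSH : ∀ c : k, c ≠ 0 → S c ∈ Hset := by
    intro c hc
    rw [hHdef]
    exact ⟨Units.mk0 c hc, 1, one_ne_zero, by simpa using hS c hc⟩
  have hτH : τ ∈ Hset := by
    rw [hHdef]
    exact ⟨1, -1, by norm_num, by simpa using hτ⟩
  have hξH : ξ ∈ Hset := by
    rw [hHdef]
    exact ⟨1, ℓ, by exact_mod_cast hl0, by simpa using hξ⟩
  -- inverses
  have hfi : ∀ σ, ∃ M, σ ∈ Hset → f σ * M = 1 ∧ M * f σ = 1 := by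
    intro σ
    by_cases h : σ ∈ Hset
    · obtain ⟨u, hu⟩ := hfu σ h
      exact ⟨(↑u⁻¹ : Matrix _ _ _), fun _ => by rw [← hu]; simp⟩
    · exact ⟨0, fun h' => absurd h' h⟩
  choose fi hfi using hfi
  have hfξ : fi ξ = B := by
    calc fi ξ = fi ξ * (f ξ * B) := by rw [hB.1, mul_one]
      _ = B := by rw [← mul_assoc, (hfi ξ hξH).2, one_mul]
  -- conjugation identity
  have hconj : ∀ σ ∈ Hset, ∀ ρ ∈ Hset, ∀ ρ' ∈ Hset, σ * ρ = ρ * ρ' →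
      f σ = f ρ * (f ρ').map ρ * (fi ρ).map σ := by
    intro σ hσ ρ hρ ρ' hρ' h
    have h1 : f σ * (f ρ).map σ = f ρ * (f ρ').map ρ := by
      rw [← hcoc _ hσ _ hρ, ← hcoc _ hρ _ hρ', h]
    rw [← h1, mul_assoc, ← map_mul', (hfi ρ hρ).1, map_one', mul_one]
  have hcc : ∀ c c' : k, c ≠ 0 → c' ≠ 0 → S c * S c' = S c' * S c := by
    intro c c' hc hc'
    apply hom_ext
    simp only [AlgHom.mul_apply, hS _ hc, hS _ hc', Algebra.smul_def, map_mul, AlgHom.commutes]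
    ring
  have hcτ : ∀ c : k, c ≠ 0 → S c * τ = τ * S c⁻¹ := by
    intro c hc
    apply hom_ext
    simp only [AlgHom.mul_apply, hS _ hc, hS _ (inv_ne_zero hc), hτ, Algebra.smul_def,
      map_mul, map_inv₀, mul_inv, AlgHom.commutes]
  have hcσ : ∀ c lam : k, ∀ q : ℤ, ∀ σ : RatFunc k →ₐ[k] RatFunc k, c ≠ 0 →
      σ RatFunc.X = lam • RatFunc.X ^ q → S c * σ = σ * S (c ^ q) := by
    intro c lam q σ hc hσ
    apply hom_ext
    simp only [AlgHom.mul_apply, hS _ hc, hS _ (zpow_ne_zero q hc), hσ, Algebra.smul_def,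
      map_mul, map_zpow₀, mul_zpow, AlgHom.commutes]
    ring
  have hcξ : ∀ c : k, c ≠ 0 → S c * ξ = ξ * S (c ^ ℓ) := by
    intro c hc
    have := hcσ c 1 ℓ ξ hc (by simpa using hξ)
    simpa using this
  -- formal expansions
  obtain ⟨pA, hpA, hpA0⟩ := exists_dom_eval fun i j => (hreg i j).1
  obtain ⟨pB, hpB, hpB0⟩ := exists_dom_eval fun i j => (hreg i j).2
  obtain ⟨Ah, hAh⟩ := RelM.exists hpA0 hpA
  obtain ⟨Bh, hBh⟩ := RelM.exists hpB0 hpB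
  have hAB : Ah * Bh = 1 := ((hAh.mul hBh).unique RelM.one).1 hB.1
  have hBA : Bh * Ah = 1 := ((hBh.mul hAh).unique RelM.one).1 hB.2
  obtain ⟨g, gi, B0, hB0, hggi, hgig, hg0, hgi0, hg⟩ := exists_gauge Ah Bh hAB ℓ hℓ
  -- Step A
  have stepA : ∀ m : ℕ, ∀ ζ : k, ζ ^ (ℓ ^ m) = 1 →
      ∃ Sh, RelM (f (S ζ)) Sh ∧ Sh * g.map (PowerSeries.rescale ζ) = g := by
    intro m
    induction m with
    | zero =>
      intro ζ hζ
      rw [pow_zero, pow_one] at hζ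
      subst hζ
      have h1 : S (1 : k) = 1 := by
        apply hom_ext
        rw [hS 1 one_ne_zero]
        simp
      have h2 := hcoc _ (hSH 1 one_ne_zero) _ (hSH 1 one_ne_zero)
      have h3 : f (S 1) = 1 := by
        have h4 : (f (S (1 : k))).map (S (1 : k)) = f (S 1) := by
          rw [h1]; ext i j; simp
        rw [h4, h1, one_mul, ← h1] at h2
        have h5 := (hfi _ (hSH (1 : k) one_ne_zero)).1
        calc f (S 1) = f (S 1) * (f (S 1) * fi (S 1)) := by rw [h5, mul_one]
          _ = 1 := by rw [← mul_assoc, ← h2, h5]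
      refine ⟨1, ?_, ?_⟩
      · rw [h3]; exact RelM.one
      · rw [one_mul, PowerSeries.rescale_one]
        ext i j : 2
        rfl
    | succ m ih =>
      intro ζ hζ
      have hζ0 : ζ ≠ 0 := Mu_ne_zero hℓ ⟨_, hζ⟩
      obtain ⟨Sh, hSh, hShg⟩ := ih (ζ ^ ℓ) (by rw [← pow_mul, ← pow_succ', hζ])
      refine ⟨Ah * Sh.map (PowerSeries.expand ℓ hl0) * Bh.map (PowerSeries.rescale ζ), ?_, ?_⟩
      · rw [hconj _ (hSH ζ hζ0) _ hξH _ (hSH _ (pow_ne_zero ℓ hζ0)) (hcξ ζ hζ0), hfξ]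
        refine (hAh.mul ?_).mul ?_
        · exact fun i j => rel_expand (hSh i j) hl0 hξ
        · exact fun i j => rel_scale (hBh i j) (hS ζ hζ0)
      · have e1 : g.map (PowerSeries.rescale ζ) = Ah.map (PowerSeries.rescale ζ) *
            (g.map (PowerSeries.rescale (ζ ^ ℓ))).map (PowerSeries.expand ℓ hl0) * B0 := by
          conv_lhs => rw [hg]
          rw [map_mul', map_mul', hB0]
          congr 2
          refine Matrix.ext fun i j => ?_
          exact rescale_expand _ _ hl0 _
        have e2 : Bh.map (PowerSeries.rescale ζ) * Ah.map (PowerSeries.rescale ζ) = 1 := by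
          rw [← map_mul', hBA, map_one']
        calc _ = Ah * Sh.map (PowerSeries.expand ℓ hl0) *
              (Bh.map (PowerSeries.rescale ζ) * Ah.map (PowerSeries.rescale ζ)) *
              (g.map (PowerSeries.rescale (ζ ^ ℓ))).map (PowerSeries.expand ℓ hl0) * B0 := by
                rw [e1]; simp only [mul_assoc]
          _ = Ah * (Sh * g.map (PowerSeries.rescale (ζ ^ ℓ))).map
                (PowerSeries.expand ℓ hl0) * B0 := by
                rw [e2, mul_one, map_mul']; simp only [mul_assoc]
          _ = g := by rw [hShg, ← hg]
  -- Step B : uniform denominators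
  have two : (2 : k) ≠ 0 := two_ne_zero
  have twoi : (2⁻¹ : k) ≠ 0 := inv_ne_zero two
  obtain ⟨e1, he1, he1'⟩ := exists_dom_ne_zero (f (S 2))
  obtain ⟨e2, he2, he2'⟩ := exists_dom_ne_zero (fi (S 2))
  obtain ⟨e3, he3, he3'⟩ := exists_dom_ne_zero (f (S 2⁻¹))
  obtain ⟨e4, he4, he4'⟩ := exists_dom_ne_zero (fi (S 2⁻¹))
  obtain ⟨a, h, hh0, heq⟩ := exists_factor
    (mul_ne_zero (mul_ne_zero he1' he2') (mul_ne_zero he3' he4'))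
  have hd1 : X ^ a * h ∈ Dom (f (S 2)) := by
    rw [← heq, mul_assoc]; exact Ideal.mul_mem_right _ _ he1
  have hd2 : X ^ a * h ∈ Dom (fi (S 2)) := by
    rw [← heq]; exact Ideal.mul_mem_right _ _ (Ideal.mul_mem_left _ _ he2)
  have hd3 : X ^ a * h ∈ Dom (f (S 2⁻¹)) := by
    rw [← heq]; exact Ideal.mul_mem_left _ _ (Ideal.mul_mem_right _ _ he3)
  have hd4 : X ^ a * h ∈ Dom (fi (S 2⁻¹)) := by
    rw [← heq]; exact Ideal.mul_mem_left _ _ (Ideal.mul_mem_left _ _ he4)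
  have hF := finite_bad h h hh0 hh0
  obtain ⟨m, hm⟩ : ∃ m : ℕ, ∀ i, m ≤ i → IsCoprime h (sc ((2 : k) ^ i) h) := by
    have hinj : Function.Injective (fun n : ℕ => (2 : k) ^ n) := by
      intro a b hab
      have : ((2 ^ a : ℕ) : k) = ((2 ^ b : ℕ) : k) := by push_cast; exact hab
      exact Nat.pow_right_injective le_rfl (Nat.cast_injective this)
    obtain ⟨m, hm⟩ := (hF.preimage hinj.injOn).bddAbove
    refine ⟨m + 1, fun i hi => ?_⟩
    by_contra hcon
    have := hm (show i ∈ _ from hcon)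
    omega
  set Z := {ζ ∈ Mu k ℓ | ∀ i : ℕ, (2 : k) ^ i * ζ ∉ {μ : k | ¬ IsCoprime h (sc μ h)} ∧
    (2 : k) ^ i * ζ⁻¹ ∉ {μ : k | ¬ IsCoprime h (sc μ h)}} with hZdef
  have hZ : Z.Infinite := Mu_good hℓ hroots _ hF
  set D : k[X] := ∏ i ∈ Finset.range m, sc ((2 : k) ^ i) h with hD
  have hD0 : D.eval 0 ≠ 0 := by
    rw [hD, eval_prod]
    refine Finset.prod_ne_zero_iff.2 fun i _ => ?_
    simpa [eval_sc] using hh0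
  have stepB : ∀ ζ ∈ Z, D * sc ζ D ∈ Dom (f (S ζ)) := by
    intro ζ hζ
    have hζ0 := Mu_ne_zero hℓ hζ.1
    obtain ⟨n, hn⟩ := hζ.1
    obtain ⟨Sh, hSh, -⟩ := stepA n ζ hn
    obtain ⟨d, hd, hd0⟩ := hSh.dom
    have key := key_poly hζ0
      (op_mem hζ0 (hS 2 two) (hS ζ hζ0) hd1 hd2
        (hconj _ (hSH ζ hζ0) _ (hSH 2 two) _ (hSH ζ hζ0) (hcc _ _ hζ0 two)) hd hd0)
      (op_mem hζ0 (hS _ twoi) (hS ζ hζ0) hd3 hd4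
        (hconj _ (hSH ζ hζ0) _ (hSH _ twoi) _ (hSH ζ hζ0) (hcc _ _ hζ0 twoi)) hd hd0)
      d hd hd0 m hm (fun i => not_not.1 (hζ.2 i).1) (fun i => not_not.1 (hζ.2 i).2)
    convert key using 1
    rw [hD, map_prod, ← Finset.prod_mul_distrib]
    refine Finset.prod_congr rfl fun i _ => ?_
    rw [map_mul, sc_sc, sc_sc, mul_comm ζ]
  -- Step C : rigidity
  obtain ⟨d, hd⟩ := val_bound (f τ) (fi τ) D
  set G : Matrix (Fin N) (Fin N) (PowerSeries k) := (D : PowerSeries k) • g with hG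
  set E : Matrix (Fin N) (Fin N) (PowerSeries k) := (D : PowerSeries k) • gi with hE
  have hrig := rigid G E Z hZ d (by
    intro ζ hζ i j n hn
    have hζ0 := Mu_ne_zero hℓ hζ.1
    obtain ⟨b, hb⟩ := hζ.1
    obtain ⟨Sh, hSh, hShg⟩ := stepA b ζ hb
    obtain ⟨b', hb'⟩ := Mu_inv hζ.1
    obtain ⟨Sh', hSh', -⟩ := stepA b' ζ⁻¹ hb'
    obtain ⟨P, hP⟩ := stepB ζ hζ i j
    have hdeg := hd ζ hζ0 (S ζ) τ (hS ζ hζ0) hτ (f (S ζ)) (f (S ζ⁻¹))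
      (hconj _ (hSH ζ hζ0) _ hτH _ (hSH _ (inv_ne_zero hζ0)) (hcτ ζ hζ0)) hSh'.dom i j P hP
    have hP2 : ((D * sc ζ D : k[X]) : PowerSeries k) * Sh i j = P :=
      (rel_unique ((CocReg.Rel k).mul_mem (rel_poly (D * sc ζ D)) (hSh i j)) (rel_poly P)).1 hP
    have hShe : Sh = g * gi.map (PowerSeries.rescale ζ) := by
      conv_rhs => rw [← hShg]
      rw [mul_assoc, ← map_mul', hggi, map_one', mul_one]
    have hGE : (G * E.map (PowerSeries.rescale ζ)) i j = P := by
      rw [← hP2, hShe, hG, hE, Matrix.mul_apply, Matrix.mul_apply, Finset.mul_sum, coe_mul,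
        ← rescale_coe]
      refine Finset.sum_congr rfl fun t _ => ?_
      simp only [Matrix.smul_apply, Matrix.map_apply, smul_eq_mul, map_mul]
      ring
    rw [hGE, Polynomial.coeff_coe]
    exact coeff_eq_zero_of_natDegree_lt (by omega))
  have hGc : ∀ M : Matrix (Fin N) (Fin N) (PowerSeries k), M.map PowerSeries.constantCoeff = 1 →
      ∀ i j, PowerSeries.coeff 0 (((D : PowerSeries k) • M) i j) =
        if i = j then D.eval 0 else 0 := by
    intro M hM i j
    have h1 := congrFun (congrFun hM i) j
    rw [Matrix.map_apply, Matrix.one_apply] at h1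
    rw [Matrix.smul_apply, smul_eq_mul, PowerSeries.coeff_zero_eq_constantCoeff_apply, map_mul,
      h1, Polynomial.constantCoeff_coe, coeff_zero_eq_eval_zero]
    split_ifs <;> simp
  have hgr : ∀ i j, ∃ r, (r, g i j) ∈ CocReg.Rel k := by
    intro i j
    refine rel_of_bounded hD0 (d := d) fun n hn => ?_
    have h1 := hrig i j n 0 (by omega)
    simp only [hE, hGc gi hgi0, mul_ite, mul_zero, Finset.sum_ite_eq', Finset.mem_univ,
      if_true] at h1
    exact (mul_eq_zero.1 h1).resolve_right hD0
  have hgir : ∀ i j, ∃ r, (r, gi i j) ∈ CocReg.Rel k := by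
    intro i j
    refine rel_of_bounded hD0 (d := d) fun n hn => ?_
    have h1 := hrig i j 0 n (by omega)
    simp only [hG, hGc g hg0, ite_mul, zero_mul, Finset.sum_ite_eq, Finset.mem_univ,
      if_true] at h1
    exact (mul_eq_zero.1 h1).resolve_left hD0
  choose γ hγ using hgr
  choose γi hγi using hgir
  have hγ' : RelM (Matrix.of γ) g := hγ
  have hγi' : RelM (Matrix.of γi) gi := hγi
  set Γ : Matrix (Fin N) (Fin N) (RatFunc k) := Matrix.of γ
  set Γi : Matrix (Fin N) (Fin N) (RatFunc k) := Matrix.of γi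
  have hΓ1 : Γ * Γi = 1 := ((hγ'.mul hγi').unique RelM.one).2 hggi
  have hΓ2 : Γi * Γ = 1 := ((hγi'.mul hγ').unique RelM.one).2 hgig
  have stepD : ∀ ζ ∈ Mu k ℓ, f (S ζ) * Γ.map (S ζ) = Γ := by
    intro ζ hζ
    have hζ0 := Mu_ne_zero hℓ hζ
    obtain ⟨b, hb⟩ := hζ
    obtain ⟨Sh, hSh, hShg⟩ := stepA b ζ hb
    have h1 : RelM (Γ.map (S ζ)) (g.map (PowerSeries.rescale ζ)) :=
      fun i j => rel_scale (hγ' i j) (hS ζ hζ0)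
    exact ((hSh.mul h1).unique hγ').2 hShg
  -- conclusion
  refine ⟨Γ, ⟨⟨Γ, Γi, hΓ1, hΓ2⟩, rfl⟩, ?_⟩
  intro σ hσ
  have hσ' := hσ
  rw [hHdef] at hσ'
  obtain ⟨lam, q, hq, hσX⟩ := hσ'
  set F : Matrix (Fin N) (Fin N) (RatFunc k) := Γi * (f σ * Γ.map σ) with hFdef
  have hΓF : Γ * F = f σ * Γ.map σ := by rw [hFdef, ← mul_assoc, hΓ1, one_mul]
  have hFinv : ∀ ζ ∈ Mu k ℓ, F.map (S ζ) = F := by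
    intro ζ hζ
    have hζ0 := Mu_ne_zero hℓ hζ
    have hq0 : ζ ^ q ≠ 0 := zpow_ne_zero _ hζ0
    have hc := hcσ ζ lam q σ hζ0 hσX
    have h1 : f (S ζ) * (f σ).map (S ζ) = f σ * (f (S (ζ ^ q))).map σ := by
      rw [← hcoc _ (hSH ζ hζ0) _ hσ, ← hcoc _ hσ _ (hSH _ hq0), hc]
    have h2 : (Γ.map σ).map (S ζ) = (Γ.map (S (ζ ^ q))).map σ := by
      ext i j
      exact DFunLike.congr_fun hc (Γ i j)
    have h3 : Γ * F.map (S ζ) = Γ * F := by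
      calc Γ * F.map (S ζ) = f (S ζ) * (Γ * F).map (S ζ) := by
            rw [map_mul' (S ζ) Γ F, ← mul_assoc, stepD ζ hζ]
        _ = f σ * ((f (S (ζ ^ q))) * Γ.map (S (ζ ^ q))).map σ := by
            rw [hΓF, map_mul' (S ζ) (f σ) (Γ.map σ), ← mul_assoc, h1, h2, map_mul' σ, mul_assoc]
        _ = Γ * F := by rw [stepD _ (Mu_zpow hζ q), hΓF]
    calc F.map (S ζ) = Γi * (Γ * F.map (S ζ)) := by rw [← mul_assoc, hΓ2, one_mul]
      _ = F := by rw [h3, ← mul_assoc, hΓ2, one_mul]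
  have hconst : ∀ i j, ∃ c : k, F i j = algebraMap k (RatFunc k) c := by
    intro i j
    refine const_of_inv (F i j) (Mu k ℓ) (Mu_infinite hℓ hroots) fun ζ hζ => ?_
    refine ⟨S ζ, hS ζ (Mu_ne_zero hℓ hζ), ?_⟩
    exact congrFun (congrFun (hFinv ζ hζ) i) j
  choose c hc using hconst
  have hCF : (Matrix.of c).map (algebraMap k (RatFunc k)) = F := by
    ext i j
    rw [Matrix.map_apply, Matrix.of_apply, hc]
  refine ⟨Matrix.of c, ?_, ?_⟩
  · rw [Matrix.isUnit_iff_isUnit_det, isUnit_iff_ne_zero]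
    intro h0
    have hFu : F * (Γi.map σ * fi σ * Γ) = 1 := by
      have e : Γ.map σ * Γi.map σ = 1 := by rw [← map_mul', hΓ1, map_one']
      calc F * (Γi.map σ * fi σ * Γ)
          = Γi * (f σ * ((Γ.map σ * Γi.map σ) * fi σ)) * Γ := by
            rw [hFdef]; simp only [mul_assoc]
        _ = 1 := by rw [e, one_mul, (hfi σ hσ).1, mul_one, hΓ2]
    have h1 := congrArg Matrix.det hFu
    rw [Matrix.det_mul, Matrix.det_one, ← hCF, ← RingHom.mapMatrix_apply, ← RingHom.map_det, h0,
      map_zero, zero_mul] at h1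
    exact zero_ne_one h1
  · rw [hCF, hΓF]
end
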